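/- Let l∈ℕ and l<a<l+1 be fixed. Take χ∈C₀^∞(ℝⁿ_ξ) with 0≤χ≤1, supp χ ⊂ {|ξ|≤a+4} and χ(ξ)=1 for |ξ|≤a+3. Then for every ξ∈ℝⁿ and every z∈ℂ with Re z<a and Im z≠0, (P̂₀(ξ)−z)^{−1} = Σ_{k=0}^{l} χ(ξ) Π_k^ξ/(ξ²+k−z) + r_l(z,ξ), where r_l(z,ξ) is holomorphic in z on {Re z<a} and sup over Re z<a and ξ∈ℝⁿ of the operator norm of r_l(z,ξ) on L²(ℝⁿ_v) is finite. -/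

import Mathlib

open MeasureTheory Real Complex Filter Topology

noncomputable section

/-- ℝⁿ (velocity variables) -/
abbrev Ev (n : ℕ) := EuclideanSpace ℝ (Fin n)
/-- L²(ℝⁿ_v) -/
abbrev HV (n : ℕ) := Lp ℂ 2 (volume : Measure (Ev n))

/-- test functions on ℝⁿ_v -/
def IsTestV (n : ℕ) (φ : Ev n → ℂ) : Prop := ContDiff ℝ (⊤ : ℕ∞) φ ∧ HasCompactSupport φ

def djV (n : ℕ) (u : Ev n → ℂ) (j : Fin n) (v : Ev n) : ℂ :=
  fderiv ℝ u v (EuclideanSpace.single j 1)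

def lapV (n : ℕ) (u : Ev n → ℂ) (v : Ev n) : ℂ :=
  ∑ j : Fin n, djV n (fun w => djV n u j w) j v

/-- the complex harmonic oscillator P̂₀(ξ) = −Δᵥ + v²/4 − n/2 + i v·ξ (it coincides with
its formal transpose w.r.t. the bilinear pairing ∫ u φ) -/
def Phat0t (n : ℕ) (ξ : Ev n) (φ : Ev n → ℂ) (v : Ev n) : ℂ :=
  -lapV n φ v + ((‖v‖ ^ 2 / 4 - (n : ℝ) / 2 : ℝ) : ℂ) * φ v
    + Complex.I * (((∑ j : Fin n, v j * ξ j : ℝ)) : ℂ) * φ v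

/-- R is the resolvent (P̂₀(ξ) − z)^{−1}, in the distributional sense -/
def IsResV (n : ℕ) (ξ : Ev n) (z : ℂ) (R : HV n →L[ℂ] HV n) : Prop :=
  ∀ f : HV n, ∀ φ : Ev n → ℂ, IsTestV n φ →
    ∫ v : Ev n, (R f) v * (Phat0t n ξ φ v - z * φ v) = ∫ v : Ev n, f v * φ v

/-- normalized Hermite function φ_j = (j!√(2π))^{−1/2} e^{−s²/4} F_j(s), extended to
complex arguments (F_j = probabilists' Hermite polynomial). -/
def phiC (j : ℕ) (z : ℂ) : ℂ :=
  ((((Nat.factorial j : ℝ) * Real.sqrt (2 * π)) ^ (-(1:ℝ)/2) : ℝ) : ℂ)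
    * Complex.exp (-z ^ 2 / 4) * Polynomial.aeval z (Polynomial.hermite j)

/-- ψ_α at complex arguments -/
def psiCN (n : ℕ) (α : Fin n → ℕ) (w : Fin n → ℂ) : ℂ := ∏ j : Fin n, phiC (α j) (w j)

/-- ψ_α^ξ(v) = ψ_α(v + 2iξ) -/
def psiXi (n : ℕ) (α : Fin n → ℕ) (ξ : Ev n) (v : Ev n) : ℂ :=
  psiCN n α (fun j => ((v j : ℝ) : ℂ) + 2 * Complex.I * ((ξ j : ℝ) : ℂ))

/-- The (probabilist) Hermite polynomials with complex coefficients. -/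
def hermiteC (j : ℕ) : Polynomial ℂ := (Polynomial.hermite j).map (Int.castRingHom ℂ)

lemma hermiteC_zero : hermiteC 0 = 1 := by simp [hermiteC]

lemma hermiteC_succ (j : ℕ) :
    hermiteC (j + 1) = Polynomial.X * hermiteC j - Polynomial.derivative (hermiteC j) := by
  simp [hermiteC, Polynomial.hermite_succ, Polynomial.derivative_map]

lemma derivative_hermiteC_succ (j : ℕ) :
    Polynomial.derivative (hermiteC (j + 1)) = ((j : ℂ) + 1) • hermiteC j := by
  induction j with
  | zero => simp [hermiteC_succ, hermiteC_zero]
  | succ j ih =>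
    rw [hermiteC_succ (j + 1), ih, Polynomial.derivative_sub, Polynomial.derivative_mul, ih,
      Polynomial.derivative_smul, Polynomial.derivative_X, hermiteC_succ j]
    simp only [Polynomial.smul_eq_C_mul]
    push_cast
    simp only [map_add, map_one]
    ring

lemma aeval_hermite (j : ℕ) (x : ℂ) :
    Polynomial.aeval x (Polynomial.hermite j) = (hermiteC j).eval x := by
  simp [hermiteC, Polynomial.aeval_def, Polynomial.eval_map]

lemma iterate_derivative_hermiteC (j m : ℕ) :
    Polynomial.derivative^[m] (hermiteC j) = (j.descFactorial m : ℂ) • hermiteC (j - m) := by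
  induction m with
  | zero => simp
  | succ m ih =>
    rw [Function.iterate_succ_apply', ih, Polynomial.derivative_smul]
    rcases lt_or_ge m j with h | h
    · obtain ⟨d, hd⟩ : ∃ d, j - m = d + 1 := ⟨j - m - 1, by omega⟩
      have h2 : j - (m + 1) = d := by omega
      rw [hd, derivative_hermiteC_succ, smul_smul, h2, Nat.descFactorial_succ, hd]
      push_cast
      congr 1
      ring
    · have : j - m = 0 := by omega
      rw [Nat.descFactorial_succ, this]
      simp [hermiteC_zero]

lemma hasseDeriv_hermiteC (j m : ℕ) :
    Polynomial.hasseDeriv m (hermiteC j) = (j.choose m : ℂ) • hermiteC (j - m) := by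
  have h := congrArg (fun F => F (hermiteC j)) (Polynomial.factorial_smul_hasseDeriv (R := ℂ) m)
  simp only [iterate_derivative_hermiteC, Nat.descFactorial_eq_factorial_mul_choose] at h
  have hm : (m.factorial : ℂ) ≠ 0 := by exact_mod_cast m.factorial_ne_zero
  have h2 : (m.factorial : ℂ) • Polynomial.hasseDeriv m (hermiteC j)
      = (m.factorial : ℂ) • ((j.choose m : ℂ) • hermiteC (j - m)) := by
    rw [smul_smul, ← Nat.cast_mul, ← h, Nat.cast_smul_eq_nsmul]
    rfl
  exact smul_right_injective _ hm h2

lemma natDegree_hermiteC (j : ℕ) : (hermiteC j).natDegree = j := by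
  rw [hermiteC, Polynomial.natDegree_map_eq_of_injective, Polynomial.natDegree_hermite]
  exact RingHom.injective_int _

/-- Taylor expansion of the Hermite polynomials. -/
lemma hermiteC_eval_add (j : ℕ) (x c : ℂ) :
    (hermiteC j).eval (x + c)
      = ∑ m ∈ Finset.range (j + 1), (j.choose m : ℂ) * c ^ m * (hermiteC (j - m)).eval x := by
  rw [add_comm x c, ← Polynomial.taylor_eval, Polynomial.eval_eq_sum_range' (n := j + 1)]
  · refine Finset.sum_congr rfl fun m _ => ?_
    rw [Polynomial.taylor_coeff, hasseDeriv_hermiteC, Polynomial.eval_smul, smul_eq_mul]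
    ring
  · rw [Polynomial.natDegree_taylor, natDegree_hermiteC]
    exact Nat.lt_succ_self j

lemma norm_cexp_neg_sq (b s η : ℝ) :
    ‖cexp (-b * ((s : ℂ) + 2 * Complex.I * η) ^ 2)‖
      = Real.exp (4 * b * η ^ 2) * Real.exp (-b * s ^ 2) := by
  rw [Complex.norm_exp, ← Real.exp_add]
  congr 1
  simp [pow_two]
  ring

lemma exists_norm_eval_le (η : ℝ) (p : Polynomial ℂ) {ε : ℝ} (hε : 0 < ε) :
    ∃ C, ∀ s : ℝ, ‖p.eval ((s : ℂ) + 2 * Complex.I * η)‖ ≤ C * Real.exp (ε * s ^ 2) := by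
  induction p using Polynomial.induction_on generalizing ε with
  | C a =>
    refine ⟨‖a‖, fun s => ?_⟩
    simp only [Polynomial.eval_C]
    exact le_mul_of_one_le_right (norm_nonneg _) (Real.one_le_exp (by positivity))
  | add p q hp hq =>
    obtain ⟨C, hC⟩ := hp hε
    obtain ⟨D, hD⟩ := hq hε
    refine ⟨C + D, fun s => ?_⟩
    rw [Polynomial.eval_add, add_mul]
    exact (norm_add_le _ _).trans (add_le_add (hC s) (hD s))
  | monomial m a ih =>
    obtain ⟨C, hC⟩ := ih (half_pos hε)
    refine ⟨C * (1 + 2 / ε + 2 * |η|), fun s => ?_⟩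
    have h1 : ‖(s : ℂ) + 2 * Complex.I * η‖ ≤ |s| + 2 * |η| := by
      refine (norm_add_le _ _).trans ?_
      simp
    have h2 : |s| + 2 * |η| ≤ (1 + 2 / ε + 2 * |η|) * Real.exp (ε / 2 * s ^ 2) := by
      have he := Real.add_one_le_exp (ε / 2 * s ^ 2)
      have he1 : 1 ≤ Real.exp (ε / 2 * s ^ 2) := Real.one_le_exp (by positivity)
      have hs : |s| ≤ 1 + s ^ 2 := by
        rw [← sq_abs]; nlinarith [sq_nonneg (|s| - 1), abs_nonneg s]
      have hs2 : s ^ 2 ≤ 2 / ε * Real.exp (ε / 2 * s ^ 2) := by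
        have : s ^ 2 = 2 / ε * (ε / 2 * s ^ 2) := by field_simp
        calc s ^ 2 = 2 / ε * (ε / 2 * s ^ 2) := this
          _ ≤ _ := by gcongr; linarith
      nlinarith [abs_nonneg η]
    rw [pow_succ, ← mul_assoc, Polynomial.eval_mul, Polynomial.eval_X, norm_mul]
    calc _ ≤ (C * Real.exp (ε / 2 * s ^ 2)) * ((1 + 2 / ε + 2 * |η|) * Real.exp (ε / 2 * s ^ 2)) :=
          mul_le_mul (hC s) (h1.trans h2) (norm_nonneg _) ((norm_nonneg _).trans (hC s))
      _ = C * (1 + 2 / ε + 2 * |η|) * (Real.exp (ε / 2 * s ^ 2) * Real.exp (ε / 2 * s ^ 2)) := by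
          ring
      _ = _ := by rw [← Real.exp_add]; ring_nf

/-- Polynomials times the shifted Gaussian weight. -/
def gaussPoly (η : ℝ) (p : Polynomial ℂ) (s : ℝ) : ℂ :=
  p.eval ((s : ℂ) + 2 * Complex.I * η) * cexp (-(1 / 2 : ℝ) * ((s : ℂ) + 2 * Complex.I * η) ^ 2)

lemma integrable_gaussPoly (η : ℝ) (p : Polynomial ℂ) : Integrable (gaussPoly η p) := by
  obtain ⟨C, hC⟩ := exists_norm_eval_le η p (ε := 1 / 4) (by norm_num)
  refine Integrable.mono' (((integrable_exp_neg_mul_sq (b := 1 / 4) (by norm_num)).const_mul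
    (C * Real.exp (2 * η ^ 2)))) ?_ (Eventually.of_forall fun s => ?_)
  · unfold gaussPoly
    exact Continuous.aestronglyMeasurable (by fun_prop)
  · rw [gaussPoly, norm_mul, norm_cexp_neg_sq]
    calc _ ≤ (C * Real.exp (1 / 4 * s ^ 2))
            * (Real.exp (4 * (1 / 2) * η ^ 2) * Real.exp (-(1 / 2) * s ^ 2)) := by
          gcongr; exact hC s
      _ = C * Real.exp (4 * (1 / 2) * η ^ 2)
            * (Real.exp (1 / 4 * s ^ 2) * Real.exp (-(1 / 2) * s ^ 2)) := by ring
      _ = _ := by rw [← Real.exp_add]; ring_nf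

/-- The moment functional of the shifted Gaussian weight. -/
def gaussMoment (η : ℝ) : Polynomial ℂ →ₗ[ℂ] ℂ where
  toFun p := ∫ s, gaussPoly η p s
  map_add' p q := by
    rw [← integral_add (integrable_gaussPoly η p) (integrable_gaussPoly η q)]
    simp [gaussPoly, add_mul]
  map_smul' c p := by
    simp only [gaussPoly, Polynomial.eval_smul, smul_eq_mul, mul_assoc, RingHom.id_apply]
    rw [integral_const_mul]

lemma gaussMoment_apply (η : ℝ) (p : Polynomial ℂ) :
    gaussMoment η p = ∫ s, gaussPoly η p s := rfl

lemma gaussMoment_X_mul (η : ℝ) (p : Polynomial ℂ) :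
    gaussMoment η (Polynomial.X * p) = gaussMoment η (Polynomial.derivative p) := by
  have hd : ∀ s : ℝ, HasDerivAt (gaussPoly η p)
      (gaussPoly η (Polynomial.derivative p - Polynomial.X * p) s) s := by
    intro s
    have hx : HasDerivAt (fun s : ℝ => (s : ℂ) + 2 * Complex.I * η) 1 s :=
      (Complex.ofRealCLM.hasDerivAt (x := s)).add_const _
    have h1 := (p.hasDerivAt ((s : ℂ) + 2 * Complex.I * η)).comp s hx
    have h2 := ((hx.pow 2).const_mul (-((1 / 2 : ℝ) : ℂ))).cexp
    refine (h1.mul h2).congr_deriv ?_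
    simp [gaussPoly]
    ring
  have h := integral_eq_zero_of_hasDerivAt_of_integrable hd (integrable_gaussPoly η _)
    (integrable_gaussPoly η _)
  rw [← gaussMoment_apply, map_sub, sub_eq_zero] at h
  exact h.symm

lemma gaussMoment_one (η : ℝ) : gaussMoment η 1 = (Real.sqrt (2 * π) : ℝ) := by
  have h := GaussianFourier.integral_cexp_neg_mul_sq_add_real_mul_I (b := ((1 / 2 : ℝ) : ℂ))
    (by norm_num) (2 * η)
  rw [gaussMoment_apply]
  simp only [gaussPoly, Polynomial.eval_one, one_mul]
  have e : ∀ s : ℝ, (s : ℂ) + 2 * Complex.I * η = s + ((2 * η : ℝ) : ℂ) * Complex.I := by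
    intro s; push_cast; ring
  simp only [e]
  rw [h, Real.sqrt_eq_rpow, Complex.ofReal_cpow (by positivity)]
  congr 1
  · push_cast; ring
  · push_cast; ring

lemma gaussMoment_hermiteC_mul (η : ℝ) (j : ℕ) (q : Polynomial ℂ) :
    gaussMoment η (hermiteC j * q) = gaussMoment η (Polynomial.derivative^[j] q) := by
  induction j generalizing q with
  | zero => simp [hermiteC_zero]
  | succ j ih =>
    have : hermiteC (j + 1) * q = Polynomial.X * (hermiteC j * q)
        - Polynomial.derivative (hermiteC j) * q := by rw [hermiteC_succ]; ring
    rw [this, map_sub, gaussMoment_X_mul, Polynomial.derivative_mul, map_add, add_sub_cancel_left,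
      ih, Function.iterate_succ_apply]

lemma gaussMoment_hermiteC_hermiteC (η : ℝ) (j k : ℕ) :
    gaussMoment η (hermiteC j * hermiteC k)
      = if j = k then (j.factorial : ℂ) * (Real.sqrt (2 * π) : ℝ) else 0 := by
  have key : ∀ j k : ℕ, k < j → gaussMoment η (hermiteC j * hermiteC k) = 0 := by
    intro j k h
    rw [gaussMoment_hermiteC_mul, iterate_derivative_hermiteC, Nat.descFactorial_of_lt h]
    simp
  rcases lt_trichotomy j k with h | h | h
  · rw [if_neg h.ne, mul_comm, key k j h]
  · subst h
    rw [if_pos rfl, gaussMoment_hermiteC_mul, iterate_derivative_hermiteC,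
      Nat.descFactorial_self, Nat.sub_self, hermiteC_zero, map_smul, gaussMoment_one, smul_eq_mul]
  · rw [if_neg h.ne', key j k h]

/-- The normalization constant of the `j`-th Hermite function. -/
def hermiteNorm (j : ℕ) : ℝ := ((Nat.factorial j : ℝ) * Real.sqrt (2 * π)) ^ (-(1:ℝ)/2)

lemma hermiteNorm_sq (j : ℕ) :
    hermiteNorm j ^ 2 = ((Nat.factorial j : ℝ) * Real.sqrt (2 * π))⁻¹ := by
  rw [hermiteNorm, ← Real.rpow_natCast, ← Real.rpow_mul (by positivity), ← Real.rpow_neg_one]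
  norm_num

lemma phiC_eq (j : ℕ) (x : ℂ) :
    phiC j x = hermiteNorm j * ((hermiteC j).eval x * cexp (-x ^ 2 / 4)) := by
  rw [phiC, aeval_hermite, hermiteNorm]
  ring

lemma integral_phiC_mul_phiC (η : ℝ) (j k : ℕ) :
    ∫ s : ℝ, phiC j ((s : ℂ) + 2 * Complex.I * η) * phiC k ((s : ℂ) + 2 * Complex.I * η)
      = if j = k then 1 else 0 := by
  have e : ∀ s : ℝ, phiC j ((s : ℂ) + 2 * Complex.I * η) * phiC k ((s : ℂ) + 2 * Complex.I * η)
      = (hermiteNorm j * hermiteNorm k : ℂ) * gaussPoly η (hermiteC j * hermiteC k) s := by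
    intro s
    have : cexp (-(1 / 2 : ℝ) * ((s : ℂ) + 2 * Complex.I * η) ^ 2)
        = cexp (-((s : ℂ) + 2 * Complex.I * η) ^ 2 / 4)
          * cexp (-((s : ℂ) + 2 * Complex.I * η) ^ 2 / 4) := by
      rw [← Complex.exp_add]; congr 1; push_cast; ring
    rw [phiC_eq, phiC_eq, gaussPoly, this, Polynomial.eval_mul]
    ring
  simp only [e]
  rw [integral_const_mul, ← gaussMoment_apply, gaussMoment_hermiteC_hermiteC]
  split_ifs with h
  · subst h
    have := hermiteNorm_sq j
    have h0 : ((Nat.factorial j : ℝ) * Real.sqrt (2 * π)) ≠ 0 := by positivity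
    rw [← Complex.ofReal_mul, ← pow_two, this, ← Complex.ofReal_natCast, ← Complex.ofReal_mul,
      ← Complex.ofReal_mul, inv_mul_cancel₀ h0, Complex.ofReal_one]
  · simp

lemma integral_normSq_hermiteC (η : ℝ) (j : ℕ) :
    ∫ s : ℝ, ‖(hermiteC j).eval ((s : ℂ) + 2 * Complex.I * η)‖ ^ 2 * Real.exp (-(1 / 2) * s ^ 2)
      = ∑ m ∈ Finset.range (j + 1), (j.choose m : ℝ) ^ 2 * (4 * η ^ 2) ^ m
          * ((j - m).factorial * Real.sqrt (2 * π)) := by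
  set c : ℂ := 2 * Complex.I * η with hc
  let A : Polynomial ℂ := ∑ m ∈ Finset.range (j + 1), ((j.choose m : ℂ) * c ^ m) • hermiteC (j - m)
  let B : Polynomial ℂ := ∑ m ∈ Finset.range (j + 1),
    ((j.choose m : ℂ) * (-c) ^ m) • hermiteC (j - m)
  have hA : ∀ s : ℝ, A.eval (s : ℂ) = (hermiteC j).eval ((s : ℂ) + c) := by
    intro s
    rw [hermiteC_eval_add]
    simp [A, Polynomial.eval_finsetSum]
  have hB : ∀ s : ℝ, B.eval (s : ℂ) = (hermiteC j).eval ((s : ℂ) + -c) := by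
    intro s
    rw [hermiteC_eval_add]
    simp only [B, Polynomial.eval_finsetSum, Polynomial.eval_smul, smul_eq_mul]
  have hconj : ∀ s : ℝ, (hermiteC j).eval ((s : ℂ) + -c)
      = (starRingEnd ℂ) ((hermiteC j).eval ((s : ℂ) + c)) := by
    intro s
    rw [← aeval_hermite, ← aeval_hermite, Polynomial.aeval_def, Polynomial.aeval_def,
      Polynomial.hom_eval₂]
    congr 1
    · exact RingHom.ext_int _ _
    · simp [hc, Complex.conj_ofNat]
  have h1 : ((∫ s : ℝ, ‖(hermiteC j).eval ((s : ℂ) + c)‖ ^ 2 * Real.exp (-(1 / 2) * s ^ 2) : ℝ) : ℂ)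
      = gaussMoment 0 (A * B) := by
    rw [gaussMoment_apply, ← integral_complex_ofReal]
    refine integral_congr_ae (Eventually.of_forall fun s => ?_)
    simp only [gaussPoly, Complex.ofReal_zero, mul_zero, add_zero]
    rw [Polynomial.eval_mul, hA, hB, hconj, Complex.mul_conj, Complex.normSq_eq_norm_sq]
    push_cast
    rfl
  have h2 : gaussMoment 0 (A * B) = ((∑ m ∈ Finset.range (j + 1),
      (j.choose m : ℝ) ^ 2 * (4 * η ^ 2) ^ m * ((j - m).factorial * Real.sqrt (2 * π)) : ℝ) : ℂ) := by
    simp only [A, B, Finset.sum_mul_sum, map_sum, smul_mul_smul_comm, map_smul,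
      gaussMoment_hermiteC_hermiteC, smul_eq_mul, Complex.ofReal_sum]
    refine Finset.sum_congr rfl fun m hm => ?_
    rw [Finset.sum_eq_single m]
    · have hcc : c ^ m * (-c) ^ m = (4 * η ^ 2 : ℂ) ^ m := by
        rw [← mul_pow, hc]
        congr 1
        linear_combination (-4 * (η : ℂ) ^ 2) * Complex.I_sq
      rw [if_pos rfl]
      push_cast
      rw [← hcc]
      ring
    · intro k hk hkm
      rw [Finset.mem_range] at hm hk
      rw [if_neg (by omega), mul_zero]
    · intro h; exact absurd hm h
  exact Complex.ofReal_injective (h1.trans h2)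

lemma integral_norm_phiC_sq_le (η : ℝ) (j : ℕ) {δ : ℝ} (hδ : 0 < δ) :
    ∫ s : ℝ, ‖phiC j ((s : ℂ) + 2 * Complex.I * η)‖ ^ 2
      ≤ Real.exp ((2 + 4 / δ) * η ^ 2) * (1 + δ) ^ j := by
  have e : ∀ s : ℝ, ‖phiC j ((s : ℂ) + 2 * Complex.I * η)‖ ^ 2
      = (hermiteNorm j ^ 2 * Real.exp (2 * η ^ 2))
        * (‖(hermiteC j).eval ((s : ℂ) + 2 * Complex.I * η)‖ ^ 2 * Real.exp (-(1 / 2) * s ^ 2)) := by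
    intro s
    have h := norm_cexp_neg_sq (1 / 4) s η
    have h' : cexp (-((s : ℂ) + 2 * Complex.I * η) ^ 2 / 4)
        = cexp (-((1 / 4 : ℝ) : ℂ) * ((s : ℂ) + 2 * Complex.I * η) ^ 2) := by
      congr 1; push_cast; ring
    rw [phiC_eq, norm_mul, norm_mul, h', h, mul_pow, mul_pow, mul_pow, ← Real.exp_nat_mul,
      ← Real.exp_nat_mul, Complex.norm_real, Real.norm_eq_abs, sq_abs]
    have e1 : ((2 : ℕ) : ℝ) * (4 * (1 / 4) * η ^ 2) = 2 * η ^ 2 := by push_cast; ring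
    have e2 : ((2 : ℕ) : ℝ) * (-(1 / 4) * s ^ 2) = -(1 / 2) * s ^ 2 := by push_cast; ring
    rw [e1, e2]
    ring
  simp only [e]
  rw [integral_const_mul, integral_normSq_hermiteC, hermiteNorm_sq]
  have hterm : ∀ m ∈ Finset.range (j + 1),
      ((j.factorial : ℝ) * Real.sqrt (2 * π))⁻¹ * ((j.choose m : ℝ) ^ 2 * (4 * η ^ 2) ^ m
          * ((j - m).factorial * Real.sqrt (2 * π)))
        ≤ Real.exp (4 / δ * η ^ 2) * (δ ^ m * 1 ^ (j - m) * (j.choose m : ℝ)) := by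
    intro m hm
    have hmj : m ≤ j := by rw [Finset.mem_range] at hm; omega
    have hch : (j.choose m : ℝ) * m.factorial * (j - m).factorial = j.factorial := by
      exact_mod_cast Nat.choose_mul_factorial_mul_factorial hmj
    have hexp := Real.pow_div_factorial_le_exp (4 / δ * η ^ 2) (by positivity) m
    have hs : (0 : ℝ) < Real.sqrt (2 * π) := by positivity
    have hf : (0 : ℝ) < m.factorial := by exact_mod_cast m.factorial_pos
    have hf2 : (0 : ℝ) < (j - m).factorial := by exact_mod_cast (j - m).factorial_pos
    have hc0 : (0 : ℝ) < j.choose m := by exact_mod_cast Nat.choose_pos hmj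
    have : ((j.factorial : ℝ) * Real.sqrt (2 * π))⁻¹ * ((j.choose m : ℝ) ^ 2 * (4 * η ^ 2) ^ m
          * ((j - m).factorial * Real.sqrt (2 * π)))
        = (4 / δ * η ^ 2) ^ m / m.factorial * (δ ^ m * 1 ^ (j - m) * (j.choose m : ℝ)) := by
      have e3 : (4 / δ * η ^ 2) ^ m * δ ^ m = (4 * η ^ 2) ^ m := by
        rw [← mul_pow]; congr 1; field_simp
      rw [← e3, ← hch]
      field_simp
      simp
    rw [this]
    gcongr
  calc _ = Real.exp (2 * η ^ 2) * ∑ m ∈ Finset.range (j + 1),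
        ((j.factorial : ℝ) * Real.sqrt (2 * π))⁻¹ * ((j.choose m : ℝ) ^ 2 * (4 * η ^ 2) ^ m
          * ((j - m).factorial * Real.sqrt (2 * π))) := by rw [← Finset.mul_sum]; ring
    _ ≤ Real.exp (2 * η ^ 2) * ∑ m ∈ Finset.range (j + 1),
        Real.exp (4 / δ * η ^ 2) * (δ ^ m * 1 ^ (j - m) * (j.choose m : ℝ)) := by
        exact mul_le_mul_of_nonneg_left (Finset.sum_le_sum hterm) (Real.exp_pos _).le
    _ = _ := by
        rw [← Finset.mul_sum, ← add_pow, ← mul_assoc, ← Real.exp_add, add_comm δ 1]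
        congr 2
        ring

/-- The complex-shifted coordinates `v + 2iξ`. -/
def cshift (n : ℕ) (ξ v : Ev n) (j : Fin n) : ℂ := ((v j : ℝ) : ℂ) + 2 * Complex.I * ((ξ j : ℝ) : ℂ)

/-- The shifted Gaussian `exp (-(v + 2iξ)² / 4)`. -/
def cgauss (n : ℕ) (ξ v : Ev n) : ℂ := cexp (-(∑ j, cshift n ξ v j ^ 2) / 4)

/-- A polynomial in `v + 2iξ` times the shifted Gaussian. -/
def gaussFun (n : ℕ) (ξ : Ev n) (p : MvPolynomial (Fin n) ℂ) (v : Ev n) : ℂ :=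
  MvPolynomial.eval (cshift n ξ v) p * cgauss n ξ v

section gaussFun

variable {n : ℕ} (ξ : Ev n)

lemma gaussFun_add (p q : MvPolynomial (Fin n) ℂ) (v : Ev n) :
    gaussFun n ξ (p + q) v = gaussFun n ξ p v + gaussFun n ξ q v := by
  simp [gaussFun, add_mul]

lemma gaussFun_sub (p q : MvPolynomial (Fin n) ℂ) (v : Ev n) :
    gaussFun n ξ (p - q) v = gaussFun n ξ p v - gaussFun n ξ q v := by
  simp [gaussFun, sub_mul]

lemma gaussFun_C_mul (c : ℂ) (p : MvPolynomial (Fin n) ℂ) (v : Ev n) :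
    gaussFun n ξ (MvPolynomial.C c * p) v = c * gaussFun n ξ p v := by
  simp [gaussFun, mul_assoc]

lemma gaussFun_smul (c : ℂ) (p : MvPolynomial (Fin n) ℂ) (v : Ev n) :
    gaussFun n ξ (c • p) v = c * gaussFun n ξ p v := by
  rw [MvPolynomial.smul_eq_C_mul, gaussFun_C_mul]

lemma gaussFun_X_mul (j : Fin n) (p : MvPolynomial (Fin n) ℂ) (v : Ev n) :
    gaussFun n ξ (MvPolynomial.X j * p) v = cshift n ξ v j * gaussFun n ξ p v := by
  simp [gaussFun, mul_assoc]

lemma gaussFun_sum {ι : Type*} (s : Finset ι) (p : ι → MvPolynomial (Fin n) ℂ) (v : Ev n) :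
    gaussFun n ξ (∑ i ∈ s, p i) v = ∑ i ∈ s, gaussFun n ξ (p i) v := by
  simp [gaussFun, Finset.sum_mul]

lemma sum_cshift_sq (v : Ev n) : ∑ j, cshift n ξ v j ^ 2
    = ((‖v‖ ^ 2 - 4 * ‖ξ‖ ^ 2 : ℝ) : ℂ) + 4 * Complex.I * ((∑ j, v j * ξ j : ℝ) : ℂ) := by
  rw [EuclideanSpace.real_norm_sq_eq, EuclideanSpace.real_norm_sq_eq]
  push_cast
  rw [Finset.mul_sum, Finset.mul_sum, ← Finset.sum_sub_distrib, ← Finset.sum_add_distrib]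
  refine Finset.sum_congr rfl fun j _ => ?_
  rw [cshift]
  linear_combination (4 * (ξ j : ℂ) ^ 2) * Complex.I_sq

lemma norm_cgauss (v : Ev n) :
    ‖cgauss n ξ v‖ = Real.exp (‖ξ‖ ^ 2) * Real.exp (-(1 / 4) * ‖v‖ ^ 2) := by
  rw [cgauss, Complex.norm_exp, sum_cshift_sq, ← Real.exp_add]
  congr 1
  rw [neg_div, Complex.neg_re]
  have : ((4 : ℂ)) = ((4 : ℝ) : ℂ) := by push_cast; rfl
  rw [this, Complex.div_ofReal_re, Complex.add_re, Complex.ofReal_re, Complex.re_mul_ofReal]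
  simp
  ring

lemma contDiff_cshift (j : Fin n) : ContDiff ℝ (⊤ : ℕ∞) (fun v => cshift n ξ v j) := by
  have h : ContDiff ℝ (⊤ : ℕ∞) (fun v : Ev n => ((v j : ℝ) : ℂ)) :=
    (Complex.ofRealCLM.comp (EuclideanSpace.proj (𝕜 := ℝ) j)).contDiff
  exact h.add contDiff_const

lemma contDiff_gaussFun (p : MvPolynomial (Fin n) ℂ) :
    ContDiff ℝ (⊤ : ℕ∞) (gaussFun n ξ p) := by
  have hp : ContDiff ℝ (⊤ : ℕ∞) (fun v => MvPolynomial.eval (cshift n ξ v) p) := by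
    induction p using MvPolynomial.induction_on with
    | C a => simpa using contDiff_const
    | add p q hp hq => simpa using hp.add hq
    | mul_X p j hp => simpa using hp.mul (contDiff_cshift ξ j)
  have hg : ContDiff ℝ (⊤ : ℕ∞) (cgauss n ξ) := by
    refine ContDiff.cexp ?_
    refine ContDiff.div_const (ContDiff.neg ?_) _
    exact ContDiff.sum fun j _ => (contDiff_cshift ξ j).pow 2
  exact hp.mul hg

lemma continuous_gaussFun (p : MvPolynomial (Fin n) ℂ) : Continuous (gaussFun n ξ p) :=
  (contDiff_gaussFun ξ p).continuous

lemma exists_norm_mvEval_le (p : MvPolynomial (Fin n) ℂ) {ε : ℝ} (hε : 0 < ε) :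
    ∃ C, ∀ v : Ev n, ‖MvPolynomial.eval (cshift n ξ v) p‖ ≤ C * Real.exp (ε * ‖v‖ ^ 2) := by
  induction p using MvPolynomial.induction_on generalizing ε with
  | C a =>
    refine ⟨‖a‖, fun s => ?_⟩
    simp only [MvPolynomial.eval_C]
    exact le_mul_of_one_le_right (norm_nonneg _) (Real.one_le_exp (by positivity))
  | add p q hp hq =>
    obtain ⟨C, hC⟩ := hp hε
    obtain ⟨D, hD⟩ := hq hε
    refine ⟨C + D, fun s => ?_⟩
    rw [map_add, add_mul]
    exact (norm_add_le _ _).trans (add_le_add (hC s) (hD s))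
  | mul_X p j ih =>
    obtain ⟨C, hC⟩ := ih (half_pos hε)
    refine ⟨C * (1 + 2 / ε + 2 * |ξ j|), fun v => ?_⟩
    have h1 : ‖cshift n ξ v j‖ ≤ ‖v‖ + 2 * |ξ j| := by
      refine (norm_add_le _ _).trans (add_le_add ?_ ?_)
      · rw [Complex.norm_real]; exact PiLp.norm_apply_le v j
      · simp
    have h2 : ‖v‖ + 2 * |ξ j| ≤ (1 + 2 / ε + 2 * |ξ j|) * Real.exp (ε / 2 * ‖v‖ ^ 2) := by
      have he := Real.add_one_le_exp (ε / 2 * ‖v‖ ^ 2)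
      have he1 : 1 ≤ Real.exp (ε / 2 * ‖v‖ ^ 2) := Real.one_le_exp (by positivity)
      have hs : ‖v‖ ≤ 1 + ‖v‖ ^ 2 := by
        nlinarith [sq_nonneg (‖v‖ - 1), norm_nonneg v]
      have hs2 : ‖v‖ ^ 2 ≤ 2 / ε * Real.exp (ε / 2 * ‖v‖ ^ 2) := by
        have : ‖v‖ ^ 2 = 2 / ε * (ε / 2 * ‖v‖ ^ 2) := by field_simp
        calc ‖v‖ ^ 2 = 2 / ε * (ε / 2 * ‖v‖ ^ 2) := this
          _ ≤ _ := by gcongr; linarith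
      nlinarith [abs_nonneg (ξ j)]
    rw [map_mul, MvPolynomial.eval_X, norm_mul]
    calc _ ≤ (C * Real.exp (ε / 2 * ‖v‖ ^ 2))
            * ((1 + 2 / ε + 2 * |ξ j|) * Real.exp (ε / 2 * ‖v‖ ^ 2)) :=
          mul_le_mul (hC v) (h1.trans h2) (norm_nonneg _) ((norm_nonneg _).trans (hC v))
      _ = C * (1 + 2 / ε + 2 * |ξ j|)
            * (Real.exp (ε / 2 * ‖v‖ ^ 2) * Real.exp (ε / 2 * ‖v‖ ^ 2)) := by ring
      _ = _ := by rw [← Real.exp_add]; ring_nf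

lemma exists_norm_gaussFun_le (p : MvPolynomial (Fin n) ℂ) :
    ∃ C, ∀ v : Ev n, ‖gaussFun n ξ p v‖ ≤ C * Real.exp (-(1 / 8) * ‖v‖ ^ 2) := by
  obtain ⟨C, hC⟩ := exists_norm_mvEval_le ξ p (ε := 1 / 8) (by norm_num)
  refine ⟨C * Real.exp (‖ξ‖ ^ 2), fun v => ?_⟩
  rw [gaussFun, norm_mul, norm_cgauss]
  calc _ ≤ (C * Real.exp (1 / 8 * ‖v‖ ^ 2))
          * (Real.exp (‖ξ‖ ^ 2) * Real.exp (-(1 / 4) * ‖v‖ ^ 2)) := by gcongr; exact hC v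
    _ = C * Real.exp (‖ξ‖ ^ 2)
          * (Real.exp (1 / 8 * ‖v‖ ^ 2) * Real.exp (-(1 / 4) * ‖v‖ ^ 2)) := by ring
    _ = _ := by rw [← Real.exp_add]; ring_nf

lemma integrable_exp_neg_mul_norm_sq {b : ℝ} (hb : 0 < b) :
    Integrable (fun v : Ev n => Real.exp (-b * ‖v‖ ^ 2)) := by
  have h := (GaussianFourier.integrable_cexp_neg_mul_sq_norm_add (V := Ev n) (b := (b : ℂ))
    (by simpa using hb) 0 0).norm
  refine h.congr (Eventually.of_forall fun v => ?_)
  simp only [zero_mul, add_zero, Complex.norm_exp]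
  congr 1
  simp [← Complex.ofReal_pow]

lemma memLp_exp_neg_mul_norm_sq {b : ℝ} (hb : 0 < b) :
    MemLp (fun v : Ev n => Real.exp (-b * ‖v‖ ^ 2)) 2 volume := by
  rw [memLp_two_iff_integrable_sq_norm (Continuous.aestronglyMeasurable (by fun_prop))]
  refine (integrable_exp_neg_mul_norm_sq (b := 2 * b) (by positivity)).congr
    (Eventually.of_forall fun v => ?_)
  simp only [Real.norm_eq_abs, sq_abs]
  rw [← Real.exp_nat_mul]
  congr 1
  push_cast
  ring

lemma memLp_gaussFun (p : MvPolynomial (Fin n) ℂ) : MemLp (gaussFun n ξ p) 2 volume := by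
  obtain ⟨C, hC⟩ := exists_norm_gaussFun_le ξ p
  exact ((memLp_exp_neg_mul_norm_sq (b := 1 / 8) (by norm_num)).const_mul C).mono'
    (continuous_gaussFun ξ p).aestronglyMeasurable (Eventually.of_forall hC)

/-- Polynomials times the shifted Gaussian as elements of `L²`. -/
def gaussLp (n : ℕ) (ξ : Ev n) : MvPolynomial (Fin n) ℂ →ₗ[ℂ] HV n where
  toFun p := (memLp_gaussFun ξ p).toLp _
  map_add' p q := by
    rw [← MemLp.toLp_add]
    exact MemLp.toLp_congr _ _ (Eventually.of_forall fun v => gaussFun_add ξ p q v)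
  map_smul' c p := by
    rw [RingHom.id_apply, ← MemLp.toLp_const_smul]
    exact MemLp.toLp_congr _ _ (Eventually.of_forall fun v => gaussFun_smul ξ c p v)

lemma coeFn_gaussLp (p : MvPolynomial (Fin n) ℂ) : gaussLp n ξ p =ᵐ[volume] gaussFun n ξ p :=
  MemLp.coeFn_toLp (memLp_gaussFun ξ p)

/-- Multiplying by the shifted Gaussian conjugates `∂_j` into this operator on polynomials. -/
def gaussDeriv (j : Fin n) (p : MvPolynomial (Fin n) ℂ) : MvPolynomial (Fin n) ℂ :=
  MvPolynomial.pderiv j p - MvPolynomial.C (1 / 2) * (MvPolynomial.X j * p)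

/-- The `j`-th coordinate as a complex-valued functional. -/
def coordC (n : ℕ) (j : Fin n) : Ev n →L[ℝ] ℂ :=
  Complex.ofRealCLM.comp (EuclideanSpace.proj (𝕜 := ℝ) j)

lemma coordC_apply (j : Fin n) (w : Ev n) : coordC n j w = ((w j : ℝ) : ℂ) := rfl

lemma hasFDerivAt_cshift (j : Fin n) (v : Ev n) :
    HasFDerivAt (fun v => cshift n ξ v j) (coordC n j) v :=
  ((coordC n j).hasFDerivAt (x := v)).add_const _

lemma hasFDerivAt_gaussFun (p : MvPolynomial (Fin n) ℂ) (v : Ev n) :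
    HasFDerivAt (gaussFun n ξ p) (∑ j, gaussFun n ξ (gaussDeriv j p) v • coordC n j) v := by
  have hp : HasFDerivAt (fun v => MvPolynomial.eval (cshift n ξ v) p)
      (∑ j, MvPolynomial.eval (cshift n ξ v) (MvPolynomial.pderiv j p) • coordC n j) v := by
    induction p using MvPolynomial.induction_on with
    | C a =>
      simp only [MvPolynomial.eval_C]
      refine (hasFDerivAt_const (𝕜 := ℝ) a v).congr_fderiv ?_
      ext w
      simp
    | add p q hp hq =>
      simp only [map_add]
      refine (hp.add hq).congr_fderiv ?_
      ext w
      simp [add_mul, Finset.sum_add_distrib]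
    | mul_X p i hp =>
      simp only [map_mul, MvPolynomial.eval_X]
      refine (hp.mul (hasFDerivAt_cshift ξ i v)).congr_fderiv ?_
      ext w
      simp only [Derivation.leibniz, MvPolynomial.pderiv_X, smul_eq_mul, map_add, map_mul,
        MvPolynomial.eval_X, add_apply, sum_apply, smul_apply, coordC_apply, add_mul,
        Finset.sum_add_distrib, Finset.mul_sum]
      congr 1
      · rw [Finset.sum_eq_single i]
        · simp
        · intro j _ hj
          simp [Ne.symm hj]
        · simp
      · exact Finset.sum_congr rfl fun j _ => by ring
  have hg : HasFDerivAt (cgauss n ξ)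
      (∑ j, (-(1 / 2) * cshift n ξ v j * cgauss n ξ v) • coordC n j) v := by
    have h1 := (((HasFDerivAt.fun_sum fun j (_ : j ∈ Finset.univ) =>
      (hasFDerivAt_cshift ξ j v).pow 2).neg).mul_const (4 : ℂ)⁻¹).cexp
    simp only [← div_eq_mul_inv] at h1
    refine h1.congr_fderiv ?_
    ext w
    simp only [smul_apply, neg_apply, sum_apply, coordC_apply, smul_eq_mul, mul_neg,
      Finset.mul_sum, ← Finset.sum_neg_distrib]
    refine Finset.sum_congr rfl fun j _ => ?_
    simp [cgauss]
    ring
  refine (hp.mul hg).congr_fderiv ?_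
  ext w
  simp only [add_apply, smul_apply, sum_apply, coordC_apply, smul_eq_mul, Finset.mul_sum,
    ← Finset.sum_add_distrib]
  refine Finset.sum_congr rfl fun j _ => ?_
  simp [gaussFun, gaussDeriv]
  ring

lemma djV_gaussFun (p : MvPolynomial (Fin n) ℂ) (j : Fin n) :
    djV n (gaussFun n ξ p) j = gaussFun n ξ (gaussDeriv j p) := by
  funext v
  rw [djV, (hasFDerivAt_gaussFun ξ p v).fderiv]
  simp only [sum_apply, smul_apply, coordC_apply]
  rw [Finset.sum_eq_single j]
  · simp
  · intro i _ hi; simp [hi]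
  · simp

/-- The complex harmonic oscillator acting on polynomials times the shifted Gaussian. -/
def polyOsc (n : ℕ) (ξ : Ev n) (p : MvPolynomial (Fin n) ℂ) : MvPolynomial (Fin n) ℂ :=
  ∑ j, (MvPolynomial.X j * MvPolynomial.pderiv j p
    - MvPolynomial.pderiv j (MvPolynomial.pderiv j p))
    + MvPolynomial.C ((‖ξ‖ ^ 2 : ℝ) : ℂ) * p

lemma neg_gaussDeriv_gaussDeriv (j : Fin n) (p : MvPolynomial (Fin n) ℂ) :
    -gaussDeriv j (gaussDeriv j p)
      = MvPolynomial.X j * MvPolynomial.pderiv j p - MvPolynomial.pderiv j (MvPolynomial.pderiv j p)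
        + MvPolynomial.C (1 / 2) * p
        - MvPolynomial.C (1 / 4) * (MvPolynomial.X j * (MvPolynomial.X j * p)) := by
  have h4 : (MvPolynomial.C (1 / 4) : MvPolynomial (Fin n) ℂ)
      = MvPolynomial.C (1 / 2) * MvPolynomial.C (1 / 2) := by
    rw [← map_mul]; norm_num
  have h2 : (MvPolynomial.C (1 / 2) : MvPolynomial (Fin n) ℂ) + MvPolynomial.C (1 / 2) = 1 := by
    rw [← map_add]; norm_num
  simp only [gaussDeriv, map_sub, Derivation.leibniz, MvPolynomial.pderiv_X_self,
    MvPolynomial.pderiv_C, smul_eq_mul, h4]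
  linear_combination (MvPolynomial.X j * MvPolynomial.pderiv j p) * h2

lemma Phat0t_gaussFun (p : MvPolynomial (Fin n) ℂ) (v : Ev n) :
    Phat0t n ξ (gaussFun n ξ p) v = gaussFun n ξ (polyOsc n ξ p) v := by
  have hl : -lapV n (gaussFun n ξ p) v = ∑ j, gaussFun n ξ (-gaussDeriv j (gaussDeriv j p)) v := by
    rw [lapV, ← Finset.sum_neg_distrib]
    refine Finset.sum_congr rfl fun j _ => ?_
    have : (fun w => djV n (gaussFun n ξ p) j w) = gaussFun n ξ (gaussDeriv j p) :=
      djV_gaussFun ξ p j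
    rw [this, djV_gaussFun]
    simp [gaussFun]
  have hs := sum_cshift_sq ξ v
  rw [Phat0t, hl, polyOsc, gaussFun_add, gaussFun_C_mul, gaussFun_sum]
  simp only [neg_gaussDeriv_gaussDeriv, gaussFun_add, gaussFun_sub, gaussFun_C_mul, gaussFun_X_mul]
  simp only [Finset.sum_sub_distrib, Finset.sum_add_distrib, Finset.sum_const, Finset.card_univ,
    Fintype.card_fin, nsmul_eq_mul]
  have e : ∑ j, 1 / 4 * (cshift n ξ v j * (cshift n ξ v j * gaussFun n ξ p v))
      = 1 / 4 * (∑ j, cshift n ξ v j ^ 2) * gaussFun n ξ p v := by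
    rw [Finset.mul_sum, Finset.sum_mul]
    exact Finset.sum_congr rfl fun j _ => by ring
  rw [e, hs]
  push_cast
  ring

end gaussFun

/-- The polynomial factor of the normalized Hermite function with multi-index `α`. -/
def psiPoly (n : ℕ) (α : Fin n → ℕ) : MvPolynomial (Fin n) ℂ :=
  MvPolynomial.C ((∏ j, hermiteNorm (α j) : ℝ) : ℂ)
    * ∏ j, Polynomial.aeval (MvPolynomial.X j) (hermiteC (α j))

lemma hermiteNorm_pos (j : ℕ) : 0 < hermiteNorm j := by
  unfold hermiteNorm
  positivity

section psi

variable {n : ℕ} (ξ : Ev n)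

lemma psiXi_eq_gaussFun (α : Fin n → ℕ) : psiXi n α ξ = gaussFun n ξ (psiPoly n α) := by
  funext v
  have h1 : ∀ j, MvPolynomial.eval (cshift n ξ v)
      (Polynomial.aeval (MvPolynomial.X j : MvPolynomial (Fin n) ℂ) (hermiteC (α j)))
      = (hermiteC (α j)).eval (cshift n ξ v j) := by
    intro j
    have := Polynomial.aeval_algHom_apply (MvPolynomial.aeval (cshift n ξ v))
      (MvPolynomial.X j : MvPolynomial (Fin n) ℂ) (hermiteC (α j))
    rw [MvPolynomial.aeval_X, Polynomial.coe_aeval_eq_eval] at this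
    rw [this]
    rfl
  have h2 : cgauss n ξ v = ∏ j, cexp (-cshift n ξ v j ^ 2 / 4) := by
    rw [cgauss, ← Complex.exp_sum, ← Finset.sum_neg_distrib, Finset.sum_div]
  rw [psiXi, psiCN, gaussFun, psiPoly, h2]
  simp only [map_mul, map_prod, MvPolynomial.eval_C, h1, phiC_eq, Complex.ofReal_prod,
    ← Finset.prod_mul_distrib]
  refine Finset.prod_congr rfl fun j _ => ?_
  rw [cshift]
  ring

lemma prod_aeval_hermiteC_split (α : Fin n → ℕ) (j : Fin n) :
    ∏ i, Polynomial.aeval (MvPolynomial.X i : MvPolynomial (Fin n) ℂ) (hermiteC (α i))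
      = Polynomial.aeval (MvPolynomial.X j) (hermiteC (α j))
        * ∏ i ∈ Finset.univ.erase j, Polynomial.aeval (MvPolynomial.X i) (hermiteC (α i)) :=
  (Finset.mul_prod_erase _ _ (Finset.mem_univ j)).symm

lemma pderiv_prod_erase_eq_zero (α : Fin n → ℕ) (j : Fin n) :
    MvPolynomial.pderiv j (∏ i ∈ Finset.univ.erase j,
      Polynomial.aeval (MvPolynomial.X i : MvPolynomial (Fin n) ℂ) (hermiteC (α i))) = 0 := by
  refine Finset.prod_induction _ (fun p => MvPolynomial.pderiv j p = 0) ?_ ?_ ?_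
  · intro p q hp hq
    rw [Derivation.leibniz, hp, hq, smul_zero, smul_zero, add_zero]
  · exact Derivation.map_one_eq_zero _
  · intro i hi
    rw [Derivation.map_aeval, MvPolynomial.pderiv_X_of_ne (Finset.ne_of_mem_erase hi), smul_zero]

lemma pderiv_psiPoly (α : Fin n → ℕ) (j : Fin n) (q : Polynomial ℂ) :
    MvPolynomial.pderiv j (Polynomial.aeval (MvPolynomial.X j) q
        * ∏ i ∈ Finset.univ.erase j,
          Polynomial.aeval (MvPolynomial.X i : MvPolynomial (Fin n) ℂ) (hermiteC (α i)))
      = Polynomial.aeval (MvPolynomial.X j) (Polynomial.derivative q)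
        * ∏ i ∈ Finset.univ.erase j,
          Polynomial.aeval (MvPolynomial.X i : MvPolynomial (Fin n) ℂ) (hermiteC (α i)) := by
  rw [Derivation.leibniz, pderiv_prod_erase_eq_zero, Derivation.map_aeval,
    MvPolynomial.pderiv_X_self]
  simp only [smul_eq_mul]
  ring

lemma hermiteC_ode (k : ℕ) :
    Polynomial.X * Polynomial.derivative (hermiteC k)
      - Polynomial.derivative (Polynomial.derivative (hermiteC k)) = (k : ℂ) • hermiteC k := by
  cases k with
  | zero => simp [hermiteC_zero]
  | succ k =>
    rw [derivative_hermiteC_succ, Polynomial.derivative_smul, hermiteC_succ]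
    push_cast
    rw [smul_sub, mul_smul_comm]

lemma polyOsc_psiPoly (α : Fin n → ℕ) :
    polyOsc n ξ (psiPoly n α)
      = MvPolynomial.C ((‖ξ‖ ^ 2 + ((∑ j, α j : ℕ) : ℝ) : ℝ) : ℂ) * psiPoly n α := by
  have h : ∀ j, MvPolynomial.X j * MvPolynomial.pderiv j (psiPoly n α)
      - MvPolynomial.pderiv j (MvPolynomial.pderiv j (psiPoly n α))
      = MvPolynomial.C (α j : ℂ) * psiPoly n α := by
    intro j
    rw [psiPoly, prod_aeval_hermiteC_split α j]
    simp only [MvPolynomial.pderiv_C_mul, pderiv_psiPoly]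
    have := congrArg (Polynomial.aeval (MvPolynomial.X j : MvPolynomial (Fin n) ℂ))
      (hermiteC_ode (α j))
    rw [map_sub, map_mul, Polynomial.aeval_X, map_smul, MvPolynomial.smul_eq_C_mul] at this
    linear_combination (MvPolynomial.C ((∏ j, hermiteNorm (α j) : ℝ) : ℂ)
      * ∏ i ∈ Finset.univ.erase j,
          Polynomial.aeval (MvPolynomial.X i : MvPolynomial (Fin n) ℂ) (hermiteC (α i))) * this
  rw [polyOsc]
  simp only [h]
  rw [← Finset.sum_mul, ← add_mul, ← map_sum, ← map_add]
  congr 2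
  push_cast
  ring

lemma X_mul_hermiteC (k : ℕ) :
    Polynomial.X * hermiteC k = hermiteC (k + 1) + (k : ℂ) • hermiteC (k - 1) := by
  cases k with
  | zero => simp [hermiteC_succ, hermiteC_zero]
  | succ k =>
    rw [hermiteC_succ (k + 1), derivative_hermiteC_succ]
    simp

lemma span_psiPoly : Submodule.span ℂ (Set.range (psiPoly n)) = ⊤ := by
  have hmem : ∀ α : Fin n → ℕ,
      ∏ i, Polynomial.aeval (MvPolynomial.X i : MvPolynomial (Fin n) ℂ) (hermiteC (α i))
        ∈ Submodule.span ℂ (Set.range (psiPoly n)) := by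
    intro α
    have h0 : ((∏ j, hermiteNorm (α j) : ℝ) : ℂ) ≠ 0 := by
      exact_mod_cast (Finset.prod_pos fun j _ => hermiteNorm_pos (α j)).ne'
    have : ∏ i, Polynomial.aeval (MvPolynomial.X i : MvPolynomial (Fin n) ℂ) (hermiteC (α i))
        = ((∏ j, hermiteNorm (α j) : ℝ) : ℂ)⁻¹ • psiPoly n α := by
      rw [psiPoly, ← MvPolynomial.smul_eq_C_mul, smul_smul, inv_mul_cancel₀ h0, one_smul]
    rw [this]
    exact Submodule.smul_mem _ _ (Submodule.subset_span ⟨α, rfl⟩)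
  have hupd : ∀ (α : Fin n → ℕ) (j : Fin n) (k : ℕ),
      Polynomial.aeval (MvPolynomial.X j : MvPolynomial (Fin n) ℂ) (hermiteC k)
        * ∏ i ∈ Finset.univ.erase j, Polynomial.aeval (MvPolynomial.X i) (hermiteC (α i))
        ∈ Submodule.span ℂ (Set.range (psiPoly n)) := by
    intro α j k
    have := hmem (Function.update α j k)
    rw [prod_aeval_hermiteC_split _ j, Function.update_self] at this
    convert this using 2
    refine Finset.prod_congr rfl fun i hi => ?_
    rw [Function.update_of_ne (Finset.ne_of_mem_erase hi)]
  have hmul : ∀ (j : Fin n) (p : MvPolynomial (Fin n) ℂ),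
      p ∈ Submodule.span ℂ (Set.range (psiPoly n)) →
      MvPolynomial.X j * p ∈ Submodule.span ℂ (Set.range (psiPoly n)) := by
    intro j p hp
    induction hp using Submodule.span_induction with
    | mem x hx =>
      obtain ⟨α, rfl⟩ := hx
      have h := congrArg (Polynomial.aeval (MvPolynomial.X j : MvPolynomial (Fin n) ℂ))
        (X_mul_hermiteC (α j))
      rw [map_add, map_mul, Polynomial.aeval_X, map_smul] at h
      rw [psiPoly, prod_aeval_hermiteC_split _ j, mul_left_comm, ← mul_assoc (MvPolynomial.X j), h,
        add_mul, ← MvPolynomial.smul_eq_C_mul, smul_mul_assoc]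
      exact Submodule.smul_mem _ _ (Submodule.add_mem _ (hupd _ _ _)
        (Submodule.smul_mem _ _ (hupd _ _ _)))
    | zero => simp
    | add x y _ _ hx hy => rw [mul_add]; exact Submodule.add_mem _ hx hy
    | smul c x _ hx => rw [mul_smul_comm]; exact Submodule.smul_mem _ _ hx
  refine eq_top_iff.2 fun p _ => ?_
  induction p using MvPolynomial.induction_on with
  | C a =>
    have h := Submodule.smul_mem _ a (hmem 0)
    simpa [hermiteC_zero, MvPolynomial.smul_eq_C_mul] using h
  | add p q hp hq => exact Submodule.add_mem _ (hp trivial) (hq trivial)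
  | mul_X p j hp => rw [mul_comm]; exact hmul j p (hp trivial)

lemma integral_prod_coord {𝕜 : Type*} [RCLike 𝕜] (f : Fin n → ℝ → 𝕜) :
    ∫ v : Ev n, ∏ j, f j (v j) = ∏ j, ∫ s : ℝ, f j s := by
  rw [← MeasureTheory.integral_fintype_prod_eq_prod (μ := fun _ => (volume : Measure ℝ)),
    ← volume_pi, ← (PiLp.volume_preserving_ofLp (Fin n)).integral_comp
      (MeasurableEquiv.toLp 2 (Fin n → ℝ)).symm.measurableEmbedding]

lemma integral_psiXi_mul_psiXi (α β : Fin n → ℕ) :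
    ∫ v : Ev n, psiXi n α ξ v * psiXi n β ξ v = if α = β then 1 else 0 := by
  simp only [psiXi, psiCN, ← Finset.prod_mul_distrib]
  rw [integral_prod_coord fun j s => phiC (α j) ((s : ℂ) + 2 * Complex.I * ((ξ j : ℝ) : ℂ))
    * phiC (β j) ((s : ℂ) + 2 * Complex.I * ((ξ j : ℝ) : ℂ))]
  simp only [integral_phiC_mul_phiC]
  rw [Finset.prod_ite_zero]
  simp [funext_iff]

lemma integral_norm_psiXi_sq_le (α : Fin n → ℕ) {δ : ℝ} (hδ : 0 < δ) :
    ∫ v : Ev n, ‖psiXi n α ξ v‖ ^ 2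
      ≤ Real.exp ((2 + 4 / δ) * ‖ξ‖ ^ 2) * (1 + δ) ^ (∑ j, α j) := by
  simp only [psiXi, psiCN, norm_prod, ← Finset.prod_pow]
  rw [integral_prod_coord fun j s =>
    ‖phiC (α j) ((s : ℂ) + 2 * Complex.I * ((ξ j : ℝ) : ℂ))‖ ^ 2,
    EuclideanSpace.real_norm_sq_eq, Finset.mul_sum, Real.exp_sum, ← Finset.prod_pow_eq_pow_sum,
    ← Finset.prod_mul_distrib]
  exact Finset.prod_le_prod (fun j _ => integral_nonneg fun s => by positivity)
    fun j _ => integral_norm_phiC_sq_le (ξ j) (α j) hδ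

/-- The normalized shifted Hermite functions as elements of `L²`. -/
def psiLp (n : ℕ) (ξ : Ev n) (α : Fin n → ℕ) : HV n := gaussLp n ξ (psiPoly n α)

lemma coeFn_psiLp (α : Fin n → ℕ) : psiLp n ξ α =ᵐ[volume] psiXi n α ξ := by
  rw [psiXi_eq_gaussFun]
  exact coeFn_gaussLp ξ _

/-- The bilinear pairing `∫ f g` on `L²`. -/
def pairing (n : ℕ) : HV n →L[ℂ] HV n →L[ℂ] ℂ :=
  (ContinuousLinearMap.mul ℂ ℂ).lpPairing volume 2 2

lemma pairing_apply (f g : HV n) : pairing n f g = ∫ v, f v * g v := by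
  rw [pairing, ContinuousLinearMap.lpPairing_eq_integral]
  rfl

lemma pairing_comm (f g : HV n) : pairing n f g = pairing n g f := by
  simp only [pairing_apply, mul_comm]

lemma pairing_gaussLp (f : HV n) (p : MvPolynomial (Fin n) ℂ) :
    pairing n f (gaussLp n ξ p) = ∫ v, f v * gaussFun n ξ p v := by
  rw [pairing_apply]
  refine integral_congr_ae ?_
  filter_upwards [coeFn_gaussLp ξ p] with v hv
  rw [hv]

lemma pairing_psiLp (f : HV n) (α : Fin n → ℕ) :
    pairing n f (psiLp n ξ α) = ∫ v, f v * psiXi n α ξ v := by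
  rw [psiXi_eq_gaussFun]
  exact pairing_gaussLp ξ f _

lemma pairing_psiLp_psiLp (α β : Fin n → ℕ) :
    pairing n (psiLp n ξ α) (psiLp n ξ β) = if α = β then 1 else 0 := by
  rw [pairing_psiLp, ← integral_psiXi_mul_psiXi ξ α β]
  refine integral_congr_ae ?_
  filter_upwards [coeFn_psiLp ξ α] with v hv
  rw [hv]

lemma norm_psiLp_sq_le (α : Fin n → ℕ) {δ : ℝ} (hδ : 0 < δ) :
    ‖psiLp n ξ α‖ ^ 2 ≤ Real.exp ((2 + 4 / δ) * ‖ξ‖ ^ 2) * (1 + δ) ^ (∑ j, α j) := by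
  refine le_trans (le_of_eq ?_) (integral_norm_psiXi_sq_le ξ α hδ)
  have h : ((‖psiLp n ξ α‖ ^ 2 : ℝ) : ℂ) = ((∫ v : Ev n, ‖psiXi n α ξ v‖ ^ 2 : ℝ) : ℂ) := by
    have := inner_self_eq_norm_sq_to_K (𝕜 := ℂ) (psiLp n ξ α)
    push_cast
    rw [← integral_complex_ofReal]
    refine this.symm.trans ?_
    rw [L2.inner_def]
    refine integral_congr_ae ?_
    filter_upwards [coeFn_psiLp ξ α] with v hv
    rw [hv, inner_self_eq_norm_sq_to_K]
    push_cast
    rfl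
  exact Complex.ofReal_injective h

end psi

section accretive

variable {n : ℕ} (ξ : Ev n)

lemma hasFDerivAt_conj_gaussFun (p : MvPolynomial (Fin n) ℂ) (v : Ev n) :
    HasFDerivAt (fun v => (starRingEnd ℂ) (gaussFun n ξ p v))
      ((Complex.conjCLE : ℂ →L[ℝ] ℂ).comp (fderiv ℝ (gaussFun n ξ p) v)) v :=
  (Complex.conjCLE : ℂ →L[ℝ] ℂ).hasFDerivAt.comp v
    (hasFDerivAt_gaussFun ξ p v).differentiableAt.hasFDerivAt

lemma fderiv_conj_gaussFun (p : MvPolynomial (Fin n) ℂ) (j : Fin n) (v : Ev n) :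
    fderiv ℝ (fun v => (starRingEnd ℂ) (gaussFun n ξ p v)) v (EuclideanSpace.single j 1)
      = (starRingEnd ℂ) (gaussFun n ξ (gaussDeriv j p) v) := by
  rw [(hasFDerivAt_conj_gaussFun ξ p v).fderiv, ← djV_gaussFun]
  rfl

lemma memLp_conj_gaussFun (p : MvPolynomial (Fin n) ℂ) :
    MemLp (fun v => (starRingEnd ℂ) (gaussFun n ξ p v)) 2 volume :=
  (memLp_gaussFun ξ p).star

lemma integrable_conj_gaussFun_mul (p q : MvPolynomial (Fin n) ℂ) :
    Integrable (fun v => (starRingEnd ℂ) (gaussFun n ξ p v) * gaussFun n ξ q v) :=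
  (memLp_conj_gaussFun ξ p).integrable_mul (memLp_gaussFun ξ q)

lemma integral_conj_gaussFun_by_parts (p q : MvPolynomial (Fin n) ℂ) (j : Fin n) :
    ∫ v, (starRingEnd ℂ) (gaussFun n ξ p v) * gaussFun n ξ (gaussDeriv j q) v
      = -∫ v, (starRingEnd ℂ) (gaussFun n ξ (gaussDeriv j p) v) * gaussFun n ξ q v := by
  have h := integral_mul_fderiv_eq_neg_fderiv_mul_of_integrable (𝕜 := ℂ) (μ := volume)
    (f := fun v => (starRingEnd ℂ) (gaussFun n ξ p v)) (g := gaussFun n ξ q)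
    (v := EuclideanSpace.single j 1)
    (by simpa only [fderiv_conj_gaussFun] using integrable_conj_gaussFun_mul ξ (gaussDeriv j p) q)
    (by
      have := integrable_conj_gaussFun_mul ξ p (gaussDeriv j q)
      rw [← djV_gaussFun] at this
      exact this)
    (integrable_conj_gaussFun_mul ξ p q)
    (fun v _ => (hasFDerivAt_conj_gaussFun ξ p v).differentiableAt)
    (fun v _ => (hasFDerivAt_gaussFun ξ q v).differentiableAt)
  simp only [fderiv_conj_gaussFun] at h
  rw [← h, ← djV_gaussFun]
  rfl

lemma inner_gaussLp (p q : MvPolynomial (Fin n) ℂ) :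
    inner ℂ (gaussLp n ξ p) (gaussLp n ξ q)
      = ∫ v, (starRingEnd ℂ) (gaussFun n ξ p v) * gaussFun n ξ q v := by
  rw [L2.inner_def]
  refine integral_congr_ae ?_
  filter_upwards [coeFn_gaussLp ξ p, coeFn_gaussLp ξ q] with v hp hq
  rw [hp, hq, RCLike.inner_apply, mul_comm]

/-- The annihilation operator `∂_j + v_j / 2` acting on polynomials times the shifted Gaussian. -/
def polyAnnihilate (ξ : Ev n) (j : Fin n) (p : MvPolynomial (Fin n) ℂ) :
    MvPolynomial (Fin n) ℂ :=
  MvPolynomial.pderiv j p - MvPolynomial.C (Complex.I * ((ξ j : ℝ) : ℂ)) * p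

lemma polyOsc_eq_sum (p : MvPolynomial (Fin n) ℂ) :
    polyOsc n ξ p = ∑ j, (MvPolynomial.X j * MvPolynomial.pderiv j p
      - MvPolynomial.pderiv j (MvPolynomial.pderiv j p)
      + MvPolynomial.C (((ξ j : ℝ) : ℂ) ^ 2) * p) := by
  rw [polyOsc, Finset.sum_add_distrib, ← Finset.sum_mul, ← map_sum, EuclideanSpace.real_norm_sq_eq]
  push_cast
  rfl

lemma inner_gaussLp_summand (p : MvPolynomial (Fin n) ℂ) (j : Fin n) :
    0 ≤ (inner ℂ (gaussLp n ξ p) (gaussLp n ξ (MvPolynomial.X j * MvPolynomial.pderiv j p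
      - MvPolynomial.pderiv j (MvPolynomial.pderiv j p)
      + MvPolynomial.C (((ξ j : ℝ) : ℂ) ^ 2) * p))).re := by
  set q := polyAnnihilate ξ j p with hq
  have hpt : ∀ v, (starRingEnd ℂ) (gaussFun n ξ p v) * gaussFun n ξ
      (MvPolynomial.X j * MvPolynomial.pderiv j p
      - MvPolynomial.pderiv j (MvPolynomial.pderiv j p)
      + MvPolynomial.C (((ξ j : ℝ) : ℂ) ^ 2) * p) v
      = (starRingEnd ℂ) (gaussFun n ξ q v) * gaussFun n ξ q v
        - (starRingEnd ℂ) (gaussFun n ξ (gaussDeriv j p) v) * gaussFun n ξ q v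
        - (starRingEnd ℂ) (gaussFun n ξ p v) * gaussFun n ξ (gaussDeriv j q) v
        + Complex.I * ((v j * ξ j * ‖gaussFun n ξ p v‖ ^ 2 : ℝ) : ℂ) := by
    intro v
    have hn : ((‖gaussFun n ξ p v‖ ^ 2 : ℝ) : ℂ)
        = (starRingEnd ℂ) (gaussFun n ξ p v) * gaussFun n ξ p v := by
      rw [mul_comm, Complex.mul_conj, Complex.normSq_eq_norm_sq]
    have hw : gaussFun n ξ q v = gaussFun n ξ (gaussDeriv j p) v
        + ((v j / 2 : ℝ) : ℂ) * gaussFun n ξ p v := by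
      simp only [hq, polyAnnihilate, gaussDeriv, gaussFun_sub, gaussFun_C_mul, gaussFun_X_mul,
        cshift]
      push_cast
      ring
    have hw2 : gaussFun n ξ (MvPolynomial.X j * MvPolynomial.pderiv j p
        - MvPolynomial.pderiv j (MvPolynomial.pderiv j p)
        + MvPolynomial.C (((ξ j : ℝ) : ℂ) ^ 2) * p) v
        = -gaussFun n ξ (gaussDeriv j q) v + ((v j / 2 : ℝ) : ℂ) * gaussFun n ξ q v
          + Complex.I * ((v j * ξ j : ℝ) : ℂ) * gaussFun n ξ p v := by
      have hd : MvPolynomial.pderiv j q = MvPolynomial.pderiv j (MvPolynomial.pderiv j p)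
          - MvPolynomial.C (Complex.I * ((ξ j : ℝ) : ℂ)) * MvPolynomial.pderiv j p := by
        rw [hq, polyAnnihilate, map_sub, MvPolynomial.pderiv_C_mul]
      rw [gaussDeriv, hd]
      simp only [hq, polyAnnihilate, gaussFun_sub, gaussFun_add, gaussFun_C_mul, gaussFun_X_mul,
        cshift]
      push_cast
      linear_combination ((ξ j : ℂ) ^ 2 * gaussFun n ξ p v) * Complex.I_sq
    have hc : (starRingEnd ℂ) (gaussFun n ξ q v) = (starRingEnd ℂ) (gaussFun n ξ (gaussDeriv j p) v)
        + ((v j / 2 : ℝ) : ℂ) * (starRingEnd ℂ) (gaussFun n ξ p v) := by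
      rw [hw, map_add, map_mul, Complex.conj_ofReal]
    rw [hw2, hc, Complex.ofReal_mul (v j * ξ j), hn]
    ring
  have hI := integrable_conj_gaussFun_mul ξ
  rw [inner_gaussLp]
  have hre := integral_re (hI p (MvPolynomial.X j * MvPolynomial.pderiv j p
      - MvPolynomial.pderiv j (MvPolynomial.pderiv j p)
      + MvPolynomial.C (((ξ j : ℝ) : ℂ) ^ 2) * p))
  refine le_of_le_of_eq ?_ hre
  have hre2 : ∀ v, RCLike.re ((starRingEnd ℂ) (gaussFun n ξ p v) * gaussFun n ξ
      (MvPolynomial.X j * MvPolynomial.pderiv j p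
      - MvPolynomial.pderiv j (MvPolynomial.pderiv j p)
      + MvPolynomial.C (((ξ j : ℝ) : ℂ) ^ 2) * p) v)
      = ‖gaussFun n ξ q v‖ ^ 2
        - RCLike.re ((starRingEnd ℂ) (gaussFun n ξ (gaussDeriv j p) v) * gaussFun n ξ q v
        + (starRingEnd ℂ) (gaussFun n ξ p v) * gaussFun n ξ (gaussDeriv j q) v) := by
    intro v
    have hn : (starRingEnd ℂ) (gaussFun n ξ q v) * gaussFun n ξ q v
        = ((‖gaussFun n ξ q v‖ ^ 2 : ℝ) : ℂ) := by
      rw [mul_comm, Complex.mul_conj, Complex.normSq_eq_norm_sq]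
    rw [hpt, hn]
    simp only [RCLike.re_to_complex, Complex.add_re, Complex.sub_re, Complex.ofReal_re,
      Complex.I_mul_re, Complex.ofReal_im]
    ring
  have hint : Integrable (fun v => (starRingEnd ℂ) (gaussFun n ξ (gaussDeriv j p) v)
      * gaussFun n ξ q v + (starRingEnd ℂ) (gaussFun n ξ p v) * gaussFun n ξ (gaussDeriv j q) v) :=
    (hI _ _).add (hI _ _)
  simp only [hre2]
  rw [integral_sub ((memLp_two_iff_integrable_sq_norm
    (continuous_gaussFun ξ q).aestronglyMeasurable).1 (memLp_gaussFun ξ q)) hint.re,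
    integral_re hint, integral_add (hI _ _) (hI _ _), integral_conj_gaussFun_by_parts]
  simp only [add_neg_cancel, map_zero, sub_zero]
  exact integral_nonneg fun v => by positivity

lemma re_inner_gaussLp_polyOsc_nonneg (p : MvPolynomial (Fin n) ℂ) :
    0 ≤ (inner ℂ (gaussLp n ξ p) (gaussLp n ξ (polyOsc n ξ p))).re := by
  rw [polyOsc_eq_sum, map_sum, inner_sum, Complex.re_sum]
  exact Finset.sum_nonneg fun j _ => inner_gaussLp_summand ξ p j

lemma norm_sum_exp_smul_psiLp_le (s : Finset (Fin n → ℕ)) (c : (Fin n → ℕ) → ℂ) {t : ℝ}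
    (ht : 0 ≤ t) :
    ‖∑ α ∈ s, (c α * Real.exp (-t * (‖ξ‖ ^ 2 + ((∑ j, α j : ℕ) : ℝ)))) • psiLp n ξ α‖
      ≤ ‖∑ α ∈ s, c α • psiLp n ξ α‖ := by
  set lam : (Fin n → ℕ) → ℝ := fun α => ‖ξ‖ ^ 2 + ((∑ j, α j : ℕ) : ℝ) with hlam
  let P : ℝ → MvPolynomial (Fin n) ℂ := fun t =>
    ∑ α ∈ s, (c α * Real.exp (-t * lam α)) • psiPoly n α
  have hP : ∀ t, gaussLp n ξ (P t) = ∑ α ∈ s, (c α * Real.exp (-t * lam α)) • psiLp n ξ α := by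
    intro t
    simp only [P, map_sum, map_smul]
    rfl
  have hosc : ∀ t, gaussLp n ξ (polyOsc n ξ (P t))
      = ∑ α ∈ s, (c α * Real.exp (-t * lam α) * lam α) • psiLp n ξ α := by
    intro t
    have : polyOsc n ξ (P t) = ∑ α ∈ s, (c α * Real.exp (-t * lam α) * lam α) • psiPoly n α := by
      have hL : ∀ q, polyOsc n ξ q = (∑ j, (LinearMap.mulLeft ℂ (MvPolynomial.X j)
          ∘ₗ (MvPolynomial.pderiv j).toLinearMap - (MvPolynomial.pderiv j).toLinearMap
            ∘ₗ (MvPolynomial.pderiv j).toLinearMap)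
          + LinearMap.mulLeft ℂ (MvPolynomial.C ((‖ξ‖ ^ 2 : ℝ) : ℂ))) q := by
        intro q
        rw [polyOsc, LinearMap.add_apply, LinearMap.sum_apply]
        rfl
      rw [hL, map_sum]
      refine Finset.sum_congr rfl fun α _ => ?_
      rw [map_smul, ← hL, polyOsc_psiPoly, ← MvPolynomial.smul_eq_C_mul, smul_smul]
    rw [this, map_sum]
    simp only [map_smul]
    rfl
  have hd : ∀ t, HasDerivAt (fun t => gaussLp n ξ (P t)) (-gaussLp n ξ (polyOsc n ξ (P t))) t := by
    intro t
    simp only [hP, hosc, ← Finset.sum_neg_distrib]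
    refine HasDerivAt.fun_sum fun α _ => ?_
    have h1 : HasDerivAt (fun t : ℝ => Real.exp (-t * lam α)) (Real.exp (-t * lam α) * -lam α) t := by
      have := ((hasDerivAt_id t).neg.mul_const (lam α)).exp
      simpa using this
    have h2 := ((h1.ofReal_comp.const_mul (c α)).smul_const (psiLp n ξ α))
    refine h2.congr_deriv ?_
    rw [← neg_smul]
    push_cast
    congr 1
    ring
  have hanti : Antitone (fun t => ‖gaussLp n ξ (P t)‖ ^ 2) := by
    have hd2 : ∀ t, HasDerivAt (fun t => ‖gaussLp n ξ (P t)‖ ^ 2)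
        (2 * (inner ℂ (gaussLp n ξ (P t)) (-gaussLp n ξ (polyOsc n ξ (P t)))).re) t := by
      intro t
      let _ : InnerProductSpace ℝ (HV n) := InnerProductSpace.rclikeToReal ℂ (HV n)
      exact (hd t).norm_sq
    refine antitone_of_deriv_nonpos (fun t => (hd2 t).differentiableAt) fun t => ?_
    rw [(hd2 t).deriv, inner_neg_right, Complex.neg_re]
    have := re_inner_gaussLp_polyOsc_nonneg ξ (P t)
    linarith
  have h := hanti ht
  simp only [hP] at h
  have h0 : ∀ α, c α * (Real.exp (-0 * lam α) : ℝ) = c α := fun α => by simp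
  simp only [h0] at h
  exact le_of_sq_le_sq h (norm_nonneg _)

end accretive

section density

variable {n : ℕ} (ξ : Ev n)

lemma ae_eq_zero_of_fourier_eq_zero {H : Ev n → ℂ} (hH : Integrable H)
    (h : ∀ w, FourierTransform.fourier H w = 0) : ∀ᵐ v, H v = 0 := by
  refine ae_eq_zero_of_integral_contDiff_smul_eq_zero hH.locallyIntegrable fun g hg hgc => ?_
  have hgC : ContDiff ℝ (⊤ : ℕ∞) (fun v => (g v : ℂ)) := Complex.ofRealCLM.contDiff.comp hg
  have hgCc : HasCompactSupport (fun v => (g v : ℂ)) :=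
    hgc.comp_left (g := fun x : ℝ => (x : ℂ)) Complex.ofReal_zero
  set G : SchwartzMap (Ev n) ℂ := hgCc.toSchwartzMap hgC with hG
  set F : SchwartzMap (Ev n) ℂ := FourierTransformInv.fourierInv G with hF
  have hFG : FourierTransform.fourier F = G := FourierTransform.fourier_fourierInv_eq G
  have key := VectorFourier.integral_bilin_fourierIntegral_eq_flip
    (ContinuousLinearMap.mul ℂ ℂ) (L := innerₗ (Ev n)) (μ := volume) (ν := volume)
    continuous_fourierChar continuous_inner hH F.integrable
  have h1 : ∀ w, VectorFourier.fourierIntegral Real.fourierChar volume (innerₗ (Ev n)) H w = 0 := h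
  have h2 : ∀ w, VectorFourier.fourierIntegral Real.fourierChar volume (innerₗ (Ev n)).flip F w = g w := by
    intro w
    have h3 : VectorFourier.fourierIntegral Real.fourierChar volume (innerₗ (Ev n)).flip F w
        = FourierTransform.fourier (F : Ev n → ℂ) w := by
      rw [flip_innerₗ]; rfl
    rw [h3, ← SchwartzMap.fourier_coe, hFG]
    rfl
  simp only [h1, h2, map_zero, zero_apply, integral_zero, ContinuousLinearMap.mul_apply'] at key
  rw [key]
  refine integral_congr_ae (Eventually.of_forall fun v => ?_)
  simp [mul_comm]

lemma continuous_cgauss : Continuous (cgauss n ξ) := by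
  refine (continuous_gaussFun ξ 1).congr fun v => ?_
  simp [gaussFun]

lemma integrable_exp_mul_mul_cgauss (h : HV n) (c : ℝ) :
    Integrable (fun v => Real.exp (c * ‖v‖) * ‖(starRingEnd ℂ) (h v) * cgauss n ξ v‖) := by
  have hc : Continuous (cgauss n ξ) := continuous_cgauss ξ
  have h1 : MemLp (fun v : Ev n => Real.exp (c * ‖v‖) * ‖cgauss n ξ v‖) 2 volume := by
    refine ((memLp_exp_neg_mul_norm_sq (b := 1 / 8) (by norm_num)).const_mul
      (Real.exp (‖ξ‖ ^ 2 + 2 * c ^ 2))).mono' (by fun_prop) (Eventually.of_forall fun v => ?_)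
    rw [norm_mul, norm_norm, norm_cgauss, Real.norm_eq_abs, Real.abs_exp, ← Real.exp_add,
      ← Real.exp_add, ← Real.exp_add]
    refine Real.exp_le_exp.2 ?_
    nlinarith [sq_nonneg (‖v‖ - 4 * c)]
  have h2 := (Lp.memLp h).norm.integrable_mul h1
  refine h2.congr (Eventually.of_forall fun v => ?_)
  simp only [Pi.mul_apply, norm_mul, RCLike.norm_conj]
  ring

lemma eq_zero_of_inner_gaussLp_eq_zero (h : HV n)
    (hh : ∀ p, inner ℂ (gaussLp n ξ p) h = 0) : h = 0 := by
  set H : Ev n → ℂ := fun v => (starRingEnd ℂ) (h v) * cgauss n ξ v with hHdef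
  have hc : Continuous (cgauss n ξ) := continuous_cgauss ξ
  have hm : AEStronglyMeasurable H volume :=
    (Lp.memLp h).star.aestronglyMeasurable.mul hc.aestronglyMeasurable
  have hHint : Integrable H := by
    have := integrable_exp_mul_mul_cgauss ξ h 0
    simp only [zero_mul, Real.exp_zero, one_mul] at this
    exact (integrable_norm_iff hm).1 this
  have hmom : ∀ p, ∫ v, MvPolynomial.eval (cshift n ξ v) p * H v = 0 := by
    intro p
    have h0 := congrArg (starRingEnd ℂ) (hh p)
    rw [map_zero, L2.inner_def, ← integral_conj] at h0
    rw [← h0]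
    refine integral_congr_ae ?_
    filter_upwards [coeFn_gaussLp ξ p] with v hv
    rw [hv, RCLike.inner_apply, map_mul, RingHomCompTriple.comp_apply, RingHom.id_apply, gaussFun,
      hHdef]
    ring
  have hfour : ∀ w, FourierTransform.fourier H w = 0 := by
    intro w
    rw [Real.fourier_eq']
    let q : ℕ → MvPolynomial (Fin n) ℂ := fun m => MvPolynomial.C ((m.factorial : ℂ)⁻¹)
      * (∑ j, MvPolynomial.C (-2 * π * (w j : ℝ) * Complex.I)
        * (MvPolynomial.X j - MvPolynomial.C (2 * Complex.I * ((ξ j : ℝ) : ℂ)))) ^ m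
    have hq : ∀ m v, MvPolynomial.eval (cshift n ξ v) (q m)
        = (((-2 * π * inner ℝ v w : ℝ) : ℂ) * Complex.I) ^ m / m.factorial := by
      intro m v
      have : ∑ j, MvPolynomial.eval (cshift n ξ v) (MvPolynomial.C (-2 * π * (w j : ℝ) * Complex.I)
          * (MvPolynomial.X j - MvPolynomial.C (2 * Complex.I * ((ξ j : ℝ) : ℂ))))
          = ((-2 * π * inner ℝ v w : ℝ) : ℂ) * Complex.I := by
        rw [PiLp.inner_apply, Finset.mul_sum, Complex.ofReal_sum, Finset.sum_mul]
        refine Finset.sum_congr rfl fun j _ => ?_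
        simp [cshift]
        ring
      simp only [q, map_mul, map_pow, map_sum, MvPolynomial.eval_C] at this ⊢
      rw [this]
      ring
    have hs := hasSum_integral_of_dominated_convergence (μ := volume)
      (F := fun m v => MvPolynomial.eval (cshift n ξ v) (q m) * H v)
      (f := fun v => cexp (((-2 * π * inner ℝ v w : ℝ) : ℂ) * Complex.I) • H v)
      (fun m v => ‖2 * π * inner ℝ v w‖ ^ m / m.factorial * ‖H v‖)
      (fun m => by
        refine AEStronglyMeasurable.mul ?_ hm
        simp only [hq]
        exact Continuous.aestronglyMeasurable (by fun_prop))
      (fun m => Eventually.of_forall fun v => by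
        rw [hq, norm_mul, norm_div, norm_pow, norm_mul, Complex.norm_I, mul_one, Complex.norm_real,
          Complex.norm_natCast]
        simp)
      (Eventually.of_forall fun v => (Real.summable_pow_div_factorial _).mul_right _)
      (by
        have he : ∀ v, ∑' m : ℕ, ‖2 * π * inner ℝ v w‖ ^ m / m.factorial * ‖H v‖
            = Real.exp ‖2 * π * inner ℝ v w‖ * ‖H v‖ := by
          intro v
          rw [tsum_mul_right, Real.exp_eq_exp_ℝ, NormedSpace.exp_eq_tsum_div]
        simp only [he]
        refine (integrable_exp_mul_mul_cgauss ξ h (2 * π * ‖w‖)).mono'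
          ((Continuous.aestronglyMeasurable (by fun_prop)).mul hm.norm)
          (Eventually.of_forall fun v => ?_)
        rw [norm_mul, norm_norm, Real.norm_eq_abs, Real.abs_exp]
        refine mul_le_mul_of_nonneg_right (Real.exp_le_exp.2 ?_) (norm_nonneg _)
        rw [norm_mul, Real.norm_of_nonneg (by positivity : 0 ≤ 2 * π), mul_assoc (2 * π) ‖w‖,
          mul_comm ‖w‖]
        exact mul_le_mul_of_nonneg_left (norm_inner_le_norm v w) (by positivity))
      (Eventually.of_forall fun v => by
        simp only [hq, smul_eq_mul]
        refine HasSum.mul_right _ ?_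
        rw [Complex.exp_eq_exp_ℂ]
        exact NormedSpace.expSeries_div_hasSum_exp _)
    simp only [hmom] at hs
    exact hs.unique hasSum_zero
  have hae := ae_eq_zero_of_fourier_eq_zero hHint hfour
  refine Lp.eq_zero_iff_ae_eq_zero.2 ?_
  filter_upwards [hae] with v hv
  have : cgauss n ξ v ≠ 0 := Complex.exp_ne_zero _
  simpa [hHdef, this] using hv

lemma topologicalClosure_span_psiLp :
    (Submodule.span ℂ (Set.range (psiLp n ξ))).topologicalClosure = ⊤ := by
  rw [Submodule.topologicalClosure_eq_top_iff, Submodule.eq_bot_iff]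
  intro h hh
  refine eq_zero_of_inner_gaussLp_eq_zero ξ h fun p => ?_
  refine (Submodule.mem_orthogonal _ _).1 hh _ ?_
  have hp : p ∈ Submodule.span ℂ (Set.range (psiPoly n)) := span_psiPoly ▸ Submodule.mem_top
  have := Submodule.mem_map_of_mem (f := gaussLp n ξ) hp
  rw [Submodule.map_span, ← Set.range_comp] at this
  exact this

lemma ext_of_psiLp {F : Type*} [AddCommMonoid F] [Module ℂ F] [TopologicalSpace F] [T2Space F]
    {A B : HV n →L[ℂ] F} (h : ∀ α, A (psiLp n ξ α) = B (psiLp n ξ α)) : A = B := by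
  refine ContinuousLinearMap.ext_on (s := Set.range (psiLp n ξ)) ?_ ?_
  · rw [Submodule.dense_iff_topologicalClosure_eq_top]
    exact topologicalClosure_span_psiLp ξ
  · rintro _ ⟨α, rfl⟩
    exact h α

end density

section weak

variable {n : ℕ} (ξ : Ev n)

lemma contDiff_djV {f : Ev n → ℂ} (hf : ContDiff ℝ (⊤ : ℕ∞) f) (j : Fin n) :
    ContDiff ℝ (⊤ : ℕ∞) (djV n f j) :=
  (hf.fderiv_right (m := (⊤ : ℕ∞)) (by simp)).clm_apply contDiff_const

lemma djV_mul {f g : Ev n → ℂ} (hf : ContDiff ℝ (⊤ : ℕ∞) f) (hg : ContDiff ℝ (⊤ : ℕ∞) g)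
    (j : Fin n) :
    djV n (fun v => f v * g v) j = fun v => djV n f j v * g v + f v * djV n g j v := by
  funext v
  have h := ((hf.differentiable (by simp) v).hasFDerivAt.mul
    (hg.differentiable (by simp) v).hasFDerivAt).fderiv
  rw [djV]
  refine (congrArg (fun L => L (EuclideanSpace.single j 1)) h).trans ?_
  simp only [add_apply, smul_apply, smul_eq_mul, djV]
  ring

lemma djV_add {f g : Ev n → ℂ} (hf : ContDiff ℝ (⊤ : ℕ∞) f) (hg : ContDiff ℝ (⊤ : ℕ∞) g)
    (j : Fin n) :
    djV n (fun v => f v + g v) j = fun v => djV n f j v + djV n g j v := by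
  funext v
  rw [djV, fderiv_fun_add (hf.differentiable (by simp) v) (hg.differentiable (by simp) v)]
  rfl

lemma djV_comp_smul {f : Ev n → ℂ} (hf : ContDiff ℝ (⊤ : ℕ∞) f) (ε : ℝ) (j : Fin n) :
    djV n (fun v => f (ε • v)) j = fun v => (ε : ℂ) * djV n f j (ε • v) := by
  funext v
  have h : HasFDerivAt (fun v => f (ε • v)) ((fderiv ℝ f (ε • v)).comp
      (ε • ContinuousLinearMap.id ℝ (Ev n))) v :=
    ((hf.differentiable (by simp) _).hasFDerivAt).comp v
      ((ContinuousLinearMap.id ℝ (Ev n)).hasFDerivAt.const_smul ε)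
  rw [djV, h.fderiv, ContinuousLinearMap.comp_apply, smul_apply, map_smul,
    Complex.real_smul]
  rfl

lemma djV_const_mul {f : Ev n → ℂ} (hf : ContDiff ℝ (⊤ : ℕ∞) f) (c : ℂ) (j : Fin n) :
    djV n (fun v => c * f v) j = fun v => c * djV n f j v := by
  funext v
  rw [djV_mul contDiff_const hf]
  simp [djV]

lemma Phat0t_cutoff_mul {E u : Ev n → ℂ} (hE : ContDiff ℝ (⊤ : ℕ∞) E)
    (hu : ContDiff ℝ (⊤ : ℕ∞) u) (ε : ℝ) (v : Ev n) :
    Phat0t n ξ (fun v => E (ε • v) * u v) v = E (ε • v) * Phat0t n ξ u v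
      - ∑ j, (2 * ε * djV n E j (ε • v) * djV n u j v
        + ε ^ 2 * djV n (djV n E j) j (ε • v) * u v) := by
  have hEε : ContDiff ℝ (⊤ : ℕ∞) (fun v => E (ε • v)) := hE.comp (contDiff_id.const_smul ε)
  have hdEε : ∀ j, ContDiff ℝ (⊤ : ℕ∞) (fun v => djV n E j (ε • v)) := fun j =>
    (contDiff_djV hE j).comp (contDiff_id.const_smul ε)
  have hl : lapV n (fun v => E (ε • v) * u v) v = E (ε • v) * lapV n u v
      + ∑ j, (2 * ε * djV n E j (ε • v) * djV n u j v
        + ε ^ 2 * djV n (djV n E j) j (ε • v) * u v) := by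
    rw [lapV, lapV, Finset.mul_sum, ← Finset.sum_add_distrib]
    refine Finset.sum_congr rfl fun j _ => ?_
    rw [djV_mul hEε hu, djV_comp_smul hE,
      djV_add ((contDiff_const.mul (hdEε j)).mul hu) (hEε.mul (contDiff_djV hu j)),
      djV_mul (contDiff_const.mul (hdEε j)) hu, djV_mul hEε (contDiff_djV hu j),
      djV_const_mul (hdEε j), djV_comp_smul hE, djV_comp_smul (contDiff_djV hE j)]
    ring
  rw [Phat0t, Phat0t, hl]
  ring

lemma integrable_cutoff_mul (h : HV n) (p : MvPolynomial (Fin n) ℂ) {K : Ev n → ℂ}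
    (hK : Continuous K) {C : ℝ} (hb : ∀ v, ‖K v‖ ≤ C) :
    Integrable (fun v => h v * (K v * gaussFun n ξ p v)) := by
  refine (Lp.memLp h).integrable_mul (q := 2) ?_
  refine ((memLp_gaussFun ξ p).norm.const_mul C).mono'
    (hK.mul (continuous_gaussFun ξ p)).aestronglyMeasurable (Eventually.of_forall fun v => ?_)
  rw [norm_mul]
  exact mul_le_mul_of_nonneg_right (hb v) (norm_nonneg _)

lemma tendsto_integral_cutoff_mul (h : HV n) (p : MvPolynomial (Fin n) ℂ) {K : ℕ → Ev n → ℂ}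
    (hK : ∀ m, Continuous (K m)) {C : ℝ} (hb : ∀ m v, ‖K m v‖ ≤ C) {k : ℂ}
    (hlim : ∀ v, Tendsto (fun m => K m v) atTop (𝓝 k)) :
    Tendsto (fun m => ∫ v, h v * (K m v * gaussFun n ξ p v)) atTop
      (𝓝 (∫ v, h v * (k * gaussFun n ξ p v))) := by
  refine tendsto_integral_of_dominated_convergence (fun v => C * ‖h v * gaussFun n ξ p v‖)
    (fun m => (integrable_cutoff_mul ξ h p (hK m) (hb m)).aestronglyMeasurable)
    (((Lp.memLp h).integrable_mul (memLp_gaussFun ξ p)).norm.const_mul C)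
    (fun m => Eventually.of_forall fun v => ?_)
    (Eventually.of_forall fun v => ((hlim v).mul_const _).const_mul _)
  rw [mul_left_comm, norm_mul]
  exact mul_le_mul_of_nonneg_right (hb m v) (norm_nonneg _)

lemma exists_cutoff (n : ℕ) : ∃ E : Ev n → ℂ, ContDiff ℝ (⊤ : ℕ∞) E ∧ HasCompactSupport E ∧
    E 0 = 1 := by
  let ρ : ContDiffBump (0 : Ev n) := ⟨1, 2, one_pos, one_lt_two⟩
  refine ⟨fun v => (ρ v : ℂ), Complex.ofRealCLM.contDiff.comp ρ.contDiff,
    ρ.hasCompactSupport.comp_left (g := fun x : ℝ => (x : ℂ)) Complex.ofReal_zero, ?_⟩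
  simp [ρ.one_of_mem_closedBall (x := 0) (by simp [ρ])]

lemma hasCompactSupport_djV {f : Ev n → ℂ} (hf : HasCompactSupport f) (j : Fin n) :
    HasCompactSupport (djV n f j) := hf.fderiv_apply ℝ _

lemma IsResV.integral_mul_gaussFun {z : ℂ} {R : HV n →L[ℂ] HV n} (hR : IsResV n ξ z R)
    (f : HV n) (p : MvPolynomial (Fin n) ℂ) :
    ∫ v, (R f) v * gaussFun n ξ (polyOsc n ξ p - MvPolynomial.C z * p) v
      = ∫ v, f v * gaussFun n ξ p v := by
  obtain ⟨E, hE, hEc, hE0⟩ := exists_cutoff n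
  have hbd : ∀ K : Ev n → ℂ, Continuous K → HasCompactSupport K → ∃ C, 0 ≤ C ∧ ∀ v, ‖K v‖ ≤ C := by
    intro K hK hKc
    obtain ⟨C, hC⟩ := hK.bounded_above_of_compact_support hKc
    exact ⟨C, (norm_nonneg _).trans (hC 0), hC⟩
  obtain ⟨C0, hC0, hE0b⟩ := hbd E hE.continuous hEc
  have hdE := fun j => contDiff_djV hE j
  have hddE := fun j => contDiff_djV (hdE j) j
  choose C1 hC1 hE1b using fun j =>
    hbd (djV n E j) (hdE j).continuous (hasCompactSupport_djV hEc j)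
  choose C2 hC2 hE2b using fun j =>
    hbd (djV n (djV n E j) j) (hddE j).continuous
      (hasCompactSupport_djV (hasCompactSupport_djV hEc j) j)
  let ε : ℕ → ℝ := fun m => 1 / ((m : ℝ) + 1)
  have hε : Tendsto ε atTop (𝓝 0) := tendsto_one_div_add_atTop_nhds_zero_nat
  have hεpos : ∀ m, 0 < ε m := fun m => by positivity
  have hε1 : ∀ m, ‖(ε m : ℂ)‖ ≤ 1 := fun m => by
    rw [Complex.norm_real, Real.norm_of_nonneg (hεpos m).le]
    exact div_le_one_of_le₀ (by linarith [(Nat.cast_nonneg m : (0 : ℝ) ≤ m)]) (by positivity)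
  have hεC : Tendsto (fun m => (ε m : ℂ)) atTop (𝓝 0) := by
    simpa [Function.comp_def] using (Complex.continuous_ofReal.tendsto 0).comp hε
  have hεv : ∀ v : Ev n, Tendsto (fun m => ε m • v) atTop (𝓝 0) := fun v => by
    simpa using hε.smul_const v
  have hu := contDiff_gaussFun ξ p
  set K0 : ℕ → Ev n → ℂ := fun m v => E (ε m • v) with hK0
  set K1 : Fin n → ℕ → Ev n → ℂ := fun j m v => 2 * ε m * djV n E j (ε m • v) with hK1
  set K2 : Fin n → ℕ → Ev n → ℂ :=
    fun j m v => (ε m : ℂ) ^ 2 * djV n (djV n E j) j (ε m • v) with hK2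
  have hsm : ∀ m, Continuous fun v : Ev n => ε m • v := fun m => continuous_const_smul _
  have hK0c : ∀ m, Continuous (K0 m) := fun m => hE.continuous.comp (hsm m)
  have hK1c : ∀ j m, Continuous (K1 j m) := fun j m =>
    continuous_const.mul ((hdE j).continuous.comp (hsm m))
  have hK2c : ∀ j m, Continuous (K2 j m) := fun j m =>
    continuous_const.mul ((hddE j).continuous.comp (hsm m))
  have hK0b : ∀ m v, ‖K0 m v‖ ≤ C0 := fun m v => hE0b _
  have hK1b : ∀ j m v, ‖K1 j m v‖ ≤ 2 * C1 j := fun j m v => by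
    rw [hK1, norm_mul, norm_mul, Complex.norm_ofNat]
    have := hE1b j (ε m • v)
    have := hε1 m
    have : ‖(ε m : ℂ)‖ * ‖djV n E j (ε m • v)‖ ≤ 1 * C1 j := by gcongr
    nlinarith
  have hK2b : ∀ j m v, ‖K2 j m v‖ ≤ C2 j := fun j m v => by
    rw [hK2, norm_mul, norm_pow]
    calc _ ≤ 1 ^ 2 * C2 j := by gcongr; exacts [hε1 m, hE2b j _]
      _ = C2 j := by ring
  have hK0l : ∀ v, Tendsto (fun m => K0 m v) atTop (𝓝 1) := fun v => by
    rw [← hE0]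
    exact (hE.continuous.tendsto 0).comp (hεv v)
  have hK1l : ∀ j v, Tendsto (fun m => K1 j m v) atTop (𝓝 0) := fun j v => by
    simpa using (hεC.const_mul 2).mul (((hdE j).continuous.tendsto 0).comp (hεv v))
  have hK2l : ∀ j v, Tendsto (fun m => K2 j m v) atTop (𝓝 0) := fun j v => by
    simpa using (hεC.pow 2).mul (((hddE j).continuous.tendsto 0).comp (hεv v))
  have hcutoff : ∀ m, IsTestV n (fun v => K0 m v * gaussFun n ξ p v) := fun m =>
    ⟨(hE.comp (contDiff_id.const_smul (ε m))).mul hu,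
      (hEc.comp_homeomorph (Homeomorph.smulOfNeZero (ε m) (hεpos m).ne')).mul_right⟩
  have hlhs : ∀ m, ∫ v, (R f) v * (Phat0t n ξ (fun v => K0 m v * gaussFun n ξ p v) v
        - z * (K0 m v * gaussFun n ξ p v))
      = (∫ v, (R f) v * (K0 m v * gaussFun n ξ (polyOsc n ξ p - MvPolynomial.C z * p) v))
        - ∑ j, ((∫ v, (R f) v * (K1 j m v * gaussFun n ξ (gaussDeriv j p) v))
          + ∫ v, (R f) v * (K2 j m v * gaussFun n ξ p v)) := by
    intro m
    have i1 := fun j => integrable_cutoff_mul ξ (R f) (gaussDeriv j p) (hK1c j m) (hK1b j m)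
    have i2 := fun j => integrable_cutoff_mul ξ (R f) p (hK2c j m) (hK2b j m)
    have i12 : ∀ j, Integrable (fun v => (R f) v * (K1 j m v * gaussFun n ξ (gaussDeriv j p) v)
        + (R f) v * (K2 j m v * gaussFun n ξ p v)) := fun j => (i1 j).add (i2 j)
    simp only [← integral_add (i1 _) (i2 _)]
    rw [← integral_finsetSum _ fun j _ => i12 j, ← integral_sub
      (integrable_cutoff_mul ξ (R f) _ (hK0c m) (hK0b m))
      (integrable_finsetSum _ fun j _ => i12 j)]
    refine integral_congr_ae (Eventually.of_forall fun v => ?_)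
    simp only [hK0]
    rw [Phat0t_cutoff_mul ξ hE hu, Phat0t_gaussFun, gaussFun_sub, gaussFun_C_mul]
    simp only [djV_gaussFun, ← mul_add, ← Finset.mul_sum, hK1, hK2]
    ring
  have hlim := (tendsto_integral_cutoff_mul ξ (R f) (polyOsc n ξ p - MvPolynomial.C z * p)
    hK0c hK0b hK0l).sub (tendsto_finsetSum Finset.univ fun j _ =>
      (tendsto_integral_cutoff_mul ξ (R f) (gaussDeriv j p) (hK1c j) (hK1b j) (hK1l j)).add
        (tendsto_integral_cutoff_mul ξ (R f) p (hK2c j) (hK2b j) (hK2l j)))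
  simp only [one_mul, zero_mul, mul_zero, integral_zero, add_zero, Finset.sum_const_zero,
    sub_zero] at hlim
  have hrhs := tendsto_integral_cutoff_mul ξ f p hK0c hK0b hK0l
  simp only [one_mul] at hrhs
  refine tendsto_nhds_unique hlim (hrhs.congr fun m => ?_)
  rw [← hR f _ (hcutoff m), hlhs]

lemma IsResV.pairing_psiLp {z : ℂ} {R : HV n →L[ℂ] HV n} (hR : IsResV n ξ z R) (f : HV n)
    (α : Fin n → ℕ) :
    (((‖ξ‖ ^ 2 + ((∑ j, α j : ℕ) : ℝ) : ℝ) : ℂ) - z) * pairing n (R f) (psiLp n ξ α)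
      = pairing n f (psiLp n ξ α) := by
  have h := hR.integral_mul_gaussFun ξ f (psiPoly n α)
  rw [polyOsc_psiPoly, ← sub_mul, ← map_sub] at h
  simp only [gaussFun_C_mul, mul_left_comm _ (_ - z) _] at h
  rw [integral_const_mul] at h
  rw [psiLp, pairing_gaussLp, pairing_gaussLp]
  exact h

end weak

/-- The multi-indices of total degree `k`. -/
def degreeLevel (n k : ℕ) : Finset (Fin n → ℕ) :=
  (Fintype.piFinset fun _ : Fin n => Finset.range (k + 1)).filter fun α => ∑ j, α j = k

lemma mem_degreeLevel {n k : ℕ} {α : Fin n → ℕ} : α ∈ degreeLevel n k ↔ ∑ j, α j = k := by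
  rw [degreeLevel, Finset.mem_filter, Fintype.mem_piFinset, and_iff_right_iff_imp]
  rintro rfl j
  exact Finset.mem_range_succ_iff.2 (Finset.single_le_sum (fun i _ => Nat.zero_le _)
    (Finset.mem_univ j))

lemma card_degreeLevel_le (n k : ℕ) : ((degreeLevel n k).card : ℝ) ≤ ((k : ℝ) + 1) ^ n := by
  have h := Finset.card_filter_le (Fintype.piFinset fun _ : Fin n => Finset.range (k + 1))
    fun α => ∑ j, α j = k
  rw [Fintype.card_piFinset] at h
  simp only [Finset.card_range, Finset.prod_const, Finset.card_univ, Fintype.card_fin] at h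
  exact_mod_cast h

/-- The spectral projection of the complex harmonic oscillator onto the level `k`. -/
def levelProj (n : ℕ) (ξ : Ev n) (k : ℕ) : HV n →L[ℂ] HV n :=
  ∑ α ∈ degreeLevel n k, ((pairing n).flip (psiLp n ξ α)).smulRight (psiLp n ξ α)

/-- The contribution of the level `k` to the semigroup of the complex harmonic oscillator. -/
def levelExp (n : ℕ) (ξ : Ev n) (t : ℝ) (k : ℕ) : HV n →L[ℂ] HV n :=
  (Real.exp (-t * (‖ξ‖ ^ 2 + k)) : ℂ) • levelProj n ξ k

/-- The semigroup of the complex harmonic oscillator, as a spectral series. -/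
def oscSemigroup (n : ℕ) (ξ : Ev n) (t : ℝ) : HV n →L[ℂ] HV n :=
  ∑' k, levelExp n ξ t k

section semigroup

variable {n : ℕ} (ξ : Ev n)

lemma levelProj_apply (k : ℕ) (f : HV n) :
    levelProj n ξ k f = ∑ α ∈ degreeLevel n k, pairing n f (psiLp n ξ α) • psiLp n ξ α := by
  rw [levelProj, sum_apply]
  rfl

lemma levelProj_psiLp (k : ℕ) (β : Fin n → ℕ) :
    levelProj n ξ k (psiLp n ξ β) = if ∑ j, β j = k then psiLp n ξ β else 0 := by
  rw [levelProj_apply]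
  simp only [pairing_psiLp_psiLp, ite_smul, one_smul, zero_smul, Finset.sum_ite_eq,
    mem_degreeLevel]

lemma pairing_levelProj (k : ℕ) (f g : HV n) :
    pairing n (levelProj n ξ k f) g
      = ∑ α ∈ degreeLevel n k, pairing n f (psiLp n ξ α) * pairing n (psiLp n ξ α) g := by
  rw [levelProj_apply, map_sum, sum_apply]
  simp only [map_smul, smul_apply, smul_eq_mul]

lemma pairing_levelProj_comm (k : ℕ) (f g : HV n) :
    pairing n (levelProj n ξ k f) g = pairing n f (levelProj n ξ k g) := by
  rw [pairing_comm f, pairing_levelProj, pairing_levelProj]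
  refine Finset.sum_congr rfl fun α _ => ?_
  rw [mul_comm, pairing_comm g, pairing_comm f]

lemma norm_levelProj_le (k : ℕ) {δ : ℝ} (hδ : 0 < δ) :
    ‖levelProj n ξ k‖ ≤ ‖pairing n‖ * Real.exp ((2 + 4 / δ) * ‖ξ‖ ^ 2)
      * (((k : ℝ) + 1) ^ n * (1 + δ) ^ k) := by
  calc ‖levelProj n ξ k‖
      ≤ ∑ α ∈ degreeLevel n k, ‖pairing n‖ * (Real.exp ((2 + 4 / δ) * ‖ξ‖ ^ 2) * (1 + δ) ^ k) := by
        refine (norm_sum_le _ _).trans (Finset.sum_le_sum fun α hα => ?_)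
        rw [ContinuousLinearMap.norm_smulRight_apply]
        have h1 : ‖(pairing n).flip (psiLp n ξ α)‖ ≤ ‖pairing n‖ * ‖psiLp n ξ α‖ := by
          refine ((pairing n).flip.le_opNorm _).trans_eq ?_
          rw [ContinuousLinearMap.opNorm_flip]
        have h2 := norm_psiLp_sq_le ξ α hδ
        rw [mem_degreeLevel.1 hα] at h2
        calc _ ≤ ‖pairing n‖ * ‖psiLp n ξ α‖ * ‖psiLp n ξ α‖ := by gcongr
          _ = ‖pairing n‖ * ‖psiLp n ξ α‖ ^ 2 := by ring
          _ ≤ _ := by gcongr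
    _ = ((degreeLevel n k).card : ℝ)
          * (‖pairing n‖ * (Real.exp ((2 + 4 / δ) * ‖ξ‖ ^ 2) * (1 + δ) ^ k)) := by
        rw [Finset.sum_const, nsmul_eq_mul]
    _ ≤ ((k : ℝ) + 1) ^ n
          * (‖pairing n‖ * (Real.exp ((2 + 4 / δ) * ‖ξ‖ ^ 2) * (1 + δ) ^ k)) := by
        gcongr
        exact card_degreeLevel_le n k
    _ = _ := by ring

lemma norm_levelExp_le (t : ℝ) (k : ℕ) {δ : ℝ} (hδ : 0 < δ) :
    ‖levelExp n ξ t k‖ ≤ ‖pairing n‖ * Real.exp ((2 + 4 / δ - t) * ‖ξ‖ ^ 2)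
      * (((k : ℝ) + 1) ^ n * ((1 + δ) * Real.exp (-t)) ^ k) := by
  rw [levelExp, norm_smul, Complex.norm_real, Real.norm_eq_abs, Real.abs_exp]
  refine (mul_le_mul_of_nonneg_left (norm_levelProj_le ξ k hδ) (Real.exp_pos _).le).trans_eq ?_
  have h1 : Real.exp (-t * (‖ξ‖ ^ 2 + k)) = Real.exp (-t * ‖ξ‖ ^ 2) * Real.exp (-t) ^ k := by
    rw [← Real.exp_nat_mul, ← Real.exp_add]
    ring_nf
  have h2 : Real.exp ((2 + 4 / δ - t) * ‖ξ‖ ^ 2)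
      = Real.exp ((2 + 4 / δ) * ‖ξ‖ ^ 2) * Real.exp (-t * ‖ξ‖ ^ 2) := by
    rw [← Real.exp_add]
    ring_nf
  rw [h1, h2, mul_pow]
  ring

lemma summable_succ_pow_mul_geometric (m : ℕ) {r : ℝ} (hr0 : 0 < r) (hr1 : r < 1) :
    Summable fun k : ℕ => ((k : ℝ) + 1) ^ m * r ^ k := by
  have h := (summable_nat_add_iff 1).2 (summable_pow_mul_geometric_of_norm_lt_one m
    (r := r) (by rwa [Real.norm_of_nonneg hr0.le]))
  refine (h.mul_right r⁻¹).congr fun k => ?_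
  push_cast
  field_simp
  ring

lemma summable_levelExp_norm {t : ℝ} (ht : 0 < t) : Summable fun k => ‖levelExp n ξ t k‖ := by
  have he : 1 < Real.exp t := Real.one_lt_exp_iff.2 ht
  have hee : Real.exp t * Real.exp (-t) = 1 := by rw [← Real.exp_add]; simp
  have hp := Real.exp_pos (-t)
  have hδ : 0 < (Real.exp t - 1) / 2 := by linarith
  refine Summable.of_nonneg_of_le (fun k => norm_nonneg _)
    (fun k => norm_levelExp_le ξ t k hδ) (Summable.mul_left _ ?_)
  refine summable_succ_pow_mul_geometric n (by positivity) ?_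
  nlinarith

lemma summable_levelExp {t : ℝ} (ht : 0 < t) : Summable fun k => levelExp n ξ t k :=
  (summable_levelExp_norm ξ ht).of_norm

lemma levelExp_psiLp (t : ℝ) (k : ℕ) (β : Fin n → ℕ) :
    levelExp n ξ t k (psiLp n ξ β) = if k = ∑ j, β j then
      (Real.exp (-t * (‖ξ‖ ^ 2 + ((∑ j, β j : ℕ) : ℝ))) : ℂ) • psiLp n ξ β else 0 := by
  rw [levelExp, smul_apply, levelProj_psiLp]
  by_cases h : k = ∑ j, β j
  · subst h; simp
  · simp [h, Ne.symm h]

lemma oscSemigroup_psiLp {t : ℝ} (ht : 0 < t) (β : Fin n → ℕ) :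
    oscSemigroup n ξ t (psiLp n ξ β)
      = (Real.exp (-t * (‖ξ‖ ^ 2 + ((∑ j, β j : ℕ) : ℝ))) : ℂ) • psiLp n ξ β := by
  have h := (ContinuousLinearMap.apply ℂ (HV n) (psiLp n ξ β)).map_tsum (summable_levelExp ξ ht)
  simp only [ContinuousLinearMap.apply_apply, levelExp_psiLp, tsum_ite_eq] at h
  exact h

lemma pairing_levelExp_comm (t : ℝ) (k : ℕ) (f g : HV n) :
    pairing n (levelExp n ξ t k f) g = pairing n f (levelExp n ξ t k g) := by
  simp only [levelExp, smul_apply, map_smul, pairing_levelProj_comm]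

lemma pairing_oscSemigroup_comm {t : ℝ} (ht : 0 < t) (f g : HV n) :
    pairing n (oscSemigroup n ξ t f) g = pairing n f (oscSemigroup n ξ t g) := by
  have h1 := ((((pairing n).flip g).comp
    (ContinuousLinearMap.apply ℂ (HV n) f))).map_tsum (summable_levelExp ξ ht)
  have h2 := (((pairing n f).comp
    (ContinuousLinearMap.apply ℂ (HV n) g))).map_tsum (summable_levelExp ξ ht)
  simp only [ContinuousLinearMap.comp_apply, ContinuousLinearMap.apply_apply,
    ContinuousLinearMap.flip_apply, pairing_levelExp_comm] at h1 h2
  exact h1.trans h2.symm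

lemma norm_oscSemigroup_le_one {t : ℝ} (ht : 0 < t) : ‖oscSemigroup n ξ t‖ ≤ 1 := by
  refine ContinuousLinearMap.opNorm_le_bound _ zero_le_one fun f => ?_
  have hdense : Dense (Submodule.span ℂ (Set.range (psiLp n ξ)) : Set (HV n)) := by
    rw [Submodule.dense_iff_topologicalClosure_eq_top]
    exact topologicalClosure_span_psiLp ξ
  rw [one_mul]
  refine hdense.induction (P := fun f => ‖oscSemigroup n ξ t f‖ ≤ ‖f‖) (fun u hu => ?_)
    (isClosed_le (oscSemigroup n ξ t).continuous.norm continuous_norm) f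
  obtain ⟨c, rfl⟩ := (Finsupp.mem_span_range_iff_exists_finsupp).1 hu
  rw [Finsupp.sum, map_sum]
  refine le_of_eq_of_le (congrArg norm (Finset.sum_congr rfl fun α _ => ?_))
    (norm_sum_exp_smul_psiLp_le ξ c.support c ht.le)
  rw [map_smul, oscSemigroup_psiLp ξ ht, smul_smul]

end semigroup

/-- The semigroup of the complex harmonic oscillator with the multiple `c` of its first
`l + 1` levels removed. -/
def truncSemigroup (n : ℕ) (ξ : Ev n) (c : ℝ) (l : ℕ) (t : ℝ) : HV n →L[ℂ] HV n :=
  oscSemigroup n ξ t - (c : ℂ) • ∑ k ∈ Finset.range (l + 1), levelExp n ξ t k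

section truncSemigroup

variable {n : ℕ} (ξ : Ev n)

lemma exp_neg_le_quarter {t : ℝ} (ht : 10 ≤ t) : Real.exp (-t) ≤ 1 / 4 := by
  have h1 := Real.add_one_le_exp t
  have h2 : Real.exp t * Real.exp (-t) = 1 := by rw [← Real.exp_add]; simp
  have h3 := Real.exp_pos (-t)
  nlinarith

lemma norm_levelExp_le_of_norm_le {t b : ℝ} (ht : 0 ≤ t) (hξ : ‖ξ‖ ≤ b) (k : ℕ) :
    ‖levelExp n ξ t k‖ ≤ ‖pairing n‖ * Real.exp (6 * b ^ 2) * (((k : ℝ) + 1) ^ n * 2 ^ k)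
      * Real.exp (-t * ‖ξ‖ ^ 2) := by
  refine (norm_levelExp_le ξ t k one_pos).trans ?_
  have h1 : Real.exp ((2 + 4 / 1 - t) * ‖ξ‖ ^ 2)
      = Real.exp (6 * ‖ξ‖ ^ 2) * Real.exp (-t * ‖ξ‖ ^ 2) := by
    rw [← Real.exp_add]
    ring_nf
  have h2 : ((1 + 1) * Real.exp (-t)) ^ k ≤ (2 : ℝ) ^ k := by
    gcongr
    have := Real.exp_le_one_iff.2 (neg_nonpos.2 ht)
    linarith
  rw [h1]
  calc _ ≤ ‖pairing n‖ * (Real.exp (6 * b ^ 2) * Real.exp (-t * ‖ξ‖ ^ 2))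
        * (((k : ℝ) + 1) ^ n * 2 ^ k) := by gcongr
    _ = _ := by ring

lemma norm_oscSemigroup_le {t : ℝ} (ht : 10 ≤ t) :
    ‖oscSemigroup n ξ t‖ ≤ ‖pairing n‖ * Real.exp ((6 - t) * ‖ξ‖ ^ 2)
      * ∑' k : ℕ, ((k : ℝ) + 1) ^ n * (1 / 2) ^ k := by
  have hS := summable_succ_pow_mul_geometric n (r := 1 / 2) (by norm_num) (by norm_num)
  refine tsum_of_norm_bounded (hS.hasSum.mul_left _) fun k => ?_
  refine (norm_levelExp_le ξ t k one_pos).trans ?_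
  have h1 := exp_neg_le_quarter ht
  have h2 : ((1 + 1) * Real.exp (-t)) ^ k ≤ (1 / 2 : ℝ) ^ k := by
    gcongr
    linarith
  have h3 : (2 + 4 / 1 - t : ℝ) = 6 - t := by ring
  rw [h3]
  gcongr

lemma norm_truncSemigroup_one_le {t b : ℝ} (ht : 10 ≤ t) (hξ : ‖ξ‖ ≤ b) (l : ℕ) :
    ‖truncSemigroup n ξ 1 l t‖ ≤ ‖pairing n‖ * Real.exp (6 * b ^ 2)
      * (((l : ℝ) + 2) ^ n * 2 ^ (l + 1)) * (∑' k : ℕ, ((k : ℝ) + 1) ^ n * (1 / 2) ^ k)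
      * Real.exp (-((l + 1) * t)) := by
  have hS := summable_succ_pow_mul_geometric n (r := 1 / 2) (by norm_num) (by norm_num)
  have ht0 : 0 < t := by linarith
  have hD : truncSemigroup n ξ 1 l t = ∑' k, levelExp n ξ t (k + (l + 1)) := by
    rw [truncSemigroup, oscSemigroup, ← (summable_levelExp ξ ht0).sum_add_tsum_nat_add (l + 1)]
    simp
  rw [hD]
  have h1 := exp_neg_le_quarter ht
  refine (tsum_of_norm_bounded (hS.hasSum.mul_left (‖pairing n‖ * Real.exp (6 * b ^ 2)
      * (((l : ℝ) + 2) ^ n * 2 ^ (l + 1)) * Real.exp (-((l + 1) * t)))) fun k => ?_).trans_eq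
    (by ring)
  refine (norm_levelExp_le ξ t _ one_pos).trans ?_
  have h2 : ((1 + 1) * Real.exp (-t)) ^ k ≤ (1 / 2 : ℝ) ^ k := by
    gcongr
    linarith
  have h3 : ((1 + 1) * Real.exp (-t)) ^ (k + (l + 1))
      = ((1 + 1) * Real.exp (-t)) ^ k * (2 ^ (l + 1) * Real.exp (-((l + 1) * t))) := by
    rw [pow_add, mul_pow _ _ (l + 1), ← Real.exp_nat_mul (-t) (l + 1)]
    push_cast
    ring_nf
  have h4 : Real.exp ((2 + 4 / 1 - t) * ‖ξ‖ ^ 2) ≤ Real.exp (6 * b ^ 2) := by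
    refine Real.exp_le_exp.2 ?_
    have : ‖ξ‖ ^ 2 ≤ b ^ 2 := by gcongr
    nlinarith [sq_nonneg ‖ξ‖]
  have h5 : (((k + (l + 1) : ℕ) : ℝ) + 1) ^ n ≤ ((l : ℝ) + 2) ^ n * ((k : ℝ) + 1) ^ n := by
    rw [← mul_pow]
    gcongr
    push_cast
    nlinarith [mul_nonneg (Nat.cast_nonneg (α := ℝ) l) (Nat.cast_nonneg (α := ℝ) k),
      Nat.cast_nonneg (α := ℝ) k]
  rw [h3]
  calc _ ≤ ‖pairing n‖ * Real.exp (6 * b ^ 2) * ((((l : ℝ) + 2) ^ n * ((k : ℝ) + 1) ^ n)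
        * ((1 / 2) ^ k * (2 ^ (l + 1) * Real.exp (-((l + 1) * t))))) := by gcongr
    _ = _ := by ring

lemma exists_norm_truncSemigroup_le (n l : ℕ) {a : ℝ} (ha : (l : ℝ) ≤ a) :
    ∃ C : ℝ, 0 ≤ C ∧ ∀ (ξ : Ev n) (c : ℝ), 0 ≤ c → c ≤ 1 → (‖ξ‖ ≤ a + 3 → c = 1) →
      (a + 4 < ‖ξ‖ → c = 0) → ∀ t : ℝ, 0 < t →
        ‖truncSemigroup n ξ c l t‖ ≤ C * Real.exp (-((l + 1) * t)) := by
  have hl : (0 : ℝ) ≤ l := Nat.cast_nonneg l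
  set K := ‖pairing n‖ with hK
  set S := ∑' k : ℕ, ((k : ℝ) + 1) ^ n * (1 / 2) ^ k with hSdef
  have hS0 : 0 ≤ S := tsum_nonneg fun k => by positivity
  set M := ∑ k ∈ Finset.range (l + 1),
    K * Real.exp (6 * (a + 4) ^ 2) * (((k : ℝ) + 1) ^ n * 2 ^ k) with hM
  have hM0 : 0 ≤ M := Finset.sum_nonneg fun k _ => by positivity
  set C₁ := (1 + M) * Real.exp (10 * (l + 1)) with hC₁
  set C₂ := K * Real.exp (6 * (a + 3) ^ 2) * (((l : ℝ) + 2) ^ n * 2 ^ (l + 1)) * S with hC₂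
  have hC₁0 : 0 ≤ C₁ := by positivity
  have hC₂0 : 0 ≤ C₂ := by positivity
  have hKS : 0 ≤ K * S := by positivity
  refine ⟨C₁ + C₂ + (K * S + M), by positivity, fun ξ c hc0 hc1 hone hzero t ht => ?_⟩
  have he := Real.exp_pos (-((l + 1) * t))
  have hsum : ‖(c : ℂ) • ∑ k ∈ Finset.range (l + 1), levelExp n ξ t k‖
      ≤ M * Real.exp (-t * ‖ξ‖ ^ 2) := by
    by_cases hξ : ‖ξ‖ ≤ a + 4
    · rw [norm_smul, Complex.norm_real, Real.norm_of_nonneg hc0, hM, Finset.sum_mul]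
      refine (mul_le_of_le_one_left (norm_nonneg _) hc1).trans ?_
      exact (norm_sum_le _ _).trans (Finset.sum_le_sum fun k _ =>
        norm_levelExp_le_of_norm_le ξ ht.le hξ k)
    · rw [hzero (not_le.1 hξ)]
      simp only [Complex.ofReal_zero, zero_smul, norm_zero]
      positivity
  rcases le_total t 10 with h10 | h10
  · have h1 : ‖truncSemigroup n ξ c l t‖ ≤ 1 + M := by
      refine (norm_sub_le _ _).trans (add_le_add (norm_oscSemigroup_le_one ξ ht)
        (hsum.trans (mul_le_of_le_one_right hM0 (Real.exp_le_one_iff.2 ?_))))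
      nlinarith [mul_nonneg ht.le (sq_nonneg ‖ξ‖)]
    have h2 : 1 + M ≤ C₁ * Real.exp (-((l + 1) * t)) := by
      rw [hC₁, mul_assoc, ← Real.exp_add]
      refine le_mul_of_one_le_right (by positivity) (Real.one_le_exp ?_)
      nlinarith
    nlinarith
  rcases le_total ‖ξ‖ (a + 3) with hξ | hξ
  · rw [hone hξ]
    have h1 := norm_truncSemigroup_one_le ξ h10 hξ l
    refine h1.trans (mul_le_mul_of_nonneg_right ?_ he.le)
    linarith
  · have hsq : (a + 3) ^ 2 ≤ ‖ξ‖ ^ 2 := by gcongr; linarith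
    have h1 : Real.exp ((6 - t) * ‖ξ‖ ^ 2) ≤ Real.exp (-((l + 1) * t)) := by
      refine Real.exp_le_exp.2 ?_
      have h3 : (l + 1) ≤ 2 / 5 * ‖ξ‖ ^ 2 := by nlinarith
      have h4 : 2 / 5 * t * ‖ξ‖ ^ 2 ≤ (t - 6) * ‖ξ‖ ^ 2 := by
        refine mul_le_mul_of_nonneg_right ?_ (sq_nonneg _)
        linarith
      nlinarith
    have h2 : Real.exp (-t * ‖ξ‖ ^ 2) ≤ Real.exp (-((l + 1) * t)) := by
      refine Real.exp_le_exp.2 ?_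
      have h3 : (l + 1) ≤ ‖ξ‖ ^ 2 := by nlinarith
      nlinarith
    calc ‖truncSemigroup n ξ c l t‖
        ≤ K * Real.exp ((6 - t) * ‖ξ‖ ^ 2) * S + M * Real.exp (-t * ‖ξ‖ ^ 2) :=
          (norm_sub_le _ _).trans (add_le_add (norm_oscSemigroup_le ξ h10) hsum)
      _ ≤ K * Real.exp (-((l + 1) * t)) * S + M * Real.exp (-((l + 1) * t)) := by gcongr
      _ = (K * S + M) * Real.exp (-((l + 1) * t)) := by ring
      _ ≤ _ := by
        refine mul_le_mul_of_nonneg_right ?_ he.le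
        linarith

lemma continuous_levelExp (k : ℕ) : Continuous fun t : ℝ => levelExp n ξ t k := by
  unfold levelExp
  fun_prop

lemma aestronglyMeasurable_truncSemigroup (c : ℝ) (l : ℕ) :
    AEStronglyMeasurable (truncSemigroup n ξ c l) (volume.restrict (Set.Ioi 0)) := by
  have h1 : AEStronglyMeasurable (oscSemigroup n ξ) (volume.restrict (Set.Ioi 0)) := by
    refine aestronglyMeasurable_of_tendsto_ae (u := atTop)
      (f := fun N : ℕ => fun t : ℝ => ∑ k ∈ Finset.range N, levelExp n ξ t k) (fun N => ?_) ?_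
    · exact (continuous_finsetSum _ fun k _ => continuous_levelExp ξ k).aestronglyMeasurable
    · filter_upwards [ae_restrict_mem measurableSet_Ioi] with t ht
      exact (summable_levelExp ξ ht).hasSum.tendsto_sum_nat
  exact h1.sub (((continuous_finsetSum _ fun k _ =>
    continuous_levelExp ξ k).const_smul (c : ℂ)).aestronglyMeasurable)

lemma pairing_truncSemigroup_psiLp (c : ℝ) (l : ℕ) {t : ℝ} (ht : 0 < t) (f : HV n)
    (β : Fin n → ℕ) :
    pairing n (truncSemigroup n ξ c l t f) (psiLp n ξ β)
      = ((1 - if ∑ j, β j ≤ l then c else 0 : ℝ) : ℂ)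
        * (Real.exp (-t * (‖ξ‖ ^ 2 + ((∑ j, β j : ℕ) : ℝ))) : ℂ)
        * pairing n f (psiLp n ξ β) := by
  have h : pairing n (truncSemigroup n ξ c l t f) (psiLp n ξ β)
      = pairing n f (truncSemigroup n ξ c l t (psiLp n ξ β)) := by
    simp only [truncSemigroup, sub_apply, smul_apply, sum_apply, map_sub, map_smul, map_sum,
      pairing_oscSemigroup_comm ξ ht, pairing_levelExp_comm]
  rw [h]
  simp only [truncSemigroup, sub_apply, smul_apply, sum_apply, oscSemigroup_psiLp ξ ht,
    levelExp_psiLp, Finset.sum_ite_eq', Finset.mem_range, Nat.lt_succ_iff]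
  split_ifs
  · simp
    ring
  · simp

end truncSemigroup

section laplace

variable {E : Type*} [NormedAddCommGroup E] [NormedSpace ℂ E]
  {F : ℝ → E} {C b : ℝ}

lemma norm_cexp_smul_le (hF : ∀ t : ℝ, 0 < t → ‖F t‖ ≤ C * Real.exp (-(b * t))) (z : ℂ) {t : ℝ}
    (ht : 0 < t) : ‖Complex.exp (t * z) • F t‖ ≤ C * Real.exp ((z.re - b) * t) := by
  rw [norm_smul, Complex.norm_exp]
  refine (mul_le_mul_of_nonneg_left (hF t ht) (Real.exp_pos _).le).trans_eq ?_
  rw [mul_left_comm, ← Real.exp_add]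
  simp only [Complex.re_ofReal_mul]
  ring_nf

lemma integrableOn_exp_mul_Ioi_zero {s : ℝ} (hs : s < 0) :
    IntegrableOn (fun t : ℝ => Real.exp (s * t)) (Set.Ioi 0) :=
  integrableOn_exp_mul_Ioi hs 0

lemma integrableOn_cexp_smul (hFm : AEStronglyMeasurable F (volume.restrict (Set.Ioi 0)))
    (hF : ∀ t : ℝ, 0 < t → ‖F t‖ ≤ C * Real.exp (-(b * t))) {z : ℂ} (hz : z.re < b) :
    IntegrableOn (fun t : ℝ => Complex.exp (t * z) • F t) (Set.Ioi 0) := by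
  refine Integrable.mono' ((integrableOn_exp_mul_Ioi_zero (sub_neg.2 hz)).const_mul C) ?_ ?_
  · refine AEStronglyMeasurable.smul (Continuous.aestronglyMeasurable ?_) hFm
    fun_prop
  · filter_upwards [ae_restrict_mem measurableSet_Ioi] with t ht
    exact norm_cexp_smul_le hF z ht

lemma norm_integral_cexp_smul_le (hF : ∀ t : ℝ, 0 < t → ‖F t‖ ≤ C * Real.exp (-(b * t)))
    {z : ℂ} (hz : z.re < b) :
    ‖∫ t in Set.Ioi (0 : ℝ), Complex.exp (t * z) • F t‖ ≤ C / (b - z.re) := by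
  have h := norm_integral_le_of_norm_le
    ((integrableOn_exp_mul_Ioi_zero (sub_neg.2 hz)).const_mul C)
    ((ae_restrict_mem measurableSet_Ioi).mono fun t ht => norm_cexp_smul_le hF z ht)
  refine h.trans_eq ?_
  rw [integral_const_mul, integral_exp_mul_Ioi (sub_neg.2 hz)]
  simp only [mul_zero, Real.exp_zero]
  rw [← neg_sub b z.re, neg_div_neg_eq, mul_one_div]

lemma differentiableOn_integral_cexp_smul
    (hFm : AEStronglyMeasurable F (volume.restrict (Set.Ioi 0))) (hC : 0 ≤ C)
    (hF : ∀ t : ℝ, 0 < t → ‖F t‖ ≤ C * Real.exp (-(b * t))) :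
    DifferentiableOn ℂ (fun z : ℂ => ∫ t in Set.Ioi (0 : ℝ), Complex.exp (t * z) • F t)
      {z | z.re < b} := by
  intro z₀ hz₀
  refine DifferentiableAt.differentiableWithinAt ?_
  have hz₀ : z₀.re < b := hz₀
  set ε := (b - z₀.re) / 3 with hε
  have hε0 : 0 < ε := by linarith
  have hre : ∀ z ∈ Metric.ball z₀ ε, z.re ≤ z₀.re + ε := fun z hz => by
    have h1 := (Complex.abs_re_le_norm (z - z₀)).trans_lt (mem_ball_iff_norm.1 hz)
    rw [Complex.sub_re] at h1
    linarith [(abs_lt.1 h1).2]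
  refine (hasDerivAt_integral_of_dominated_loc_of_deriv_le (μ := volume.restrict (Set.Ioi 0))
    (s := Metric.ball z₀ ε) (F := fun z t => Complex.exp (t * z) • F t)
    (F' := fun z t => ((t : ℂ) * Complex.exp (t * z)) • F t)
    (bound := fun t => ε⁻¹ * C * Real.exp (-ε * t)) (Metric.ball_mem_nhds z₀ hε0)
    (Eventually.of_forall fun z => ?_) (integrableOn_cexp_smul hFm hF hz₀) ?_ ?_ ?_ ?_).2
    |>.differentiableAt
  · refine AEStronglyMeasurable.smul (Continuous.aestronglyMeasurable ?_) hFm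
    fun_prop
  · refine AEStronglyMeasurable.smul (Continuous.aestronglyMeasurable ?_) hFm
    fun_prop
  · filter_upwards [ae_restrict_mem measurableSet_Ioi] with t ht z hz
    have ht : 0 < t := ht
    rw [mul_smul, norm_smul, Complex.norm_real, Real.norm_of_nonneg ht.le]
    have h1 := norm_cexp_smul_le hF z ht
    have h2 : t ≤ ε⁻¹ * Real.exp (ε * t) := by
      rw [← div_eq_inv_mul, le_div_iff₀ hε0]
      linarith [Real.add_one_le_exp (ε * t)]
    have h3 : Real.exp ((z.re - b) * t) ≤ Real.exp (-(2 * ε) * t) := by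
      refine Real.exp_le_exp.2 (mul_le_mul_of_nonneg_right ?_ ht.le)
      have := hre z hz
      linarith
    calc t * ‖Complex.exp (t * z) • F t‖
        ≤ (ε⁻¹ * Real.exp (ε * t)) * (C * Real.exp (-(2 * ε) * t)) :=
          mul_le_mul h2 (h1.trans (mul_le_mul_of_nonneg_left h3 hC)) (norm_nonneg _)
            (by positivity)
      _ = ε⁻¹ * C * (Real.exp (ε * t) * Real.exp (-(2 * ε) * t)) := by ring
      _ = _ := by
        rw [← Real.exp_add]
        ring_nf
  · exact (integrableOn_exp_mul_Ioi_zero (neg_neg_of_pos hε0)).const_mul _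
  · refine Eventually.of_forall fun t z _ => ?_
    have h := ((hasDerivAt_id z).const_mul (t : ℂ)).cexp.smul_const (F t)
    refine h.congr_deriv ?_
    simp [mul_comm]

end laplace

/-- The holomorphic remainder in the resolvent of the complex harmonic oscillator: the Laplace
transform of the truncated semigroup. -/
def resolventRemainder (n : ℕ) (ξ : Ev n) (c : ℝ) (l : ℕ) (z : ℂ) : HV n →L[ℂ] HV n :=
  ∫ t in Set.Ioi (0 : ℝ), Complex.exp (t * z) • truncSemigroup n ξ c l t

section remainder

variable {n : ℕ} (ξ : Ev n)

lemma conj_phiC (j : ℕ) (z : ℂ) : (starRingEnd ℂ) (phiC j z) = phiC j ((starRingEnd ℂ) z) := by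
  have h : (starRingEnd ℂ) (Polynomial.aeval z (Polynomial.hermite j))
      = Polynomial.aeval ((starRingEnd ℂ) z) (Polynomial.hermite j) := by
    have := Polynomial.hom_eval₂ (Polynomial.hermite j) (algebraMap ℤ ℂ) (starRingEnd ℂ) z
    rw [Polynomial.aeval_def, this, Polynomial.aeval_def]
    congr 1
    exact Subsingleton.elim _ _
  simp only [phiC, map_mul, Complex.conj_ofReal, h, ← Complex.exp_conj, map_div₀, map_neg,
    map_pow, Complex.conj_ofNat]

lemma conj_psiXi_neg (α : Fin n → ℕ) (v : Ev n) :
    (starRingEnd ℂ) (psiXi n α (-ξ) v) = psiXi n α ξ v := by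
  simp only [psiXi, psiCN, map_prod, conj_phiC]
  refine Finset.prod_congr rfl fun j _ => congrArg _ ?_
  simp [Complex.conj_ofNat]

lemma sum_integral_psiXi_eq (k : ℕ) (f g : HV n) :
    (∑ α ∈ Fintype.piFinset (fun _ : Fin n => Finset.range (k + 1)),
      if (∑ j : Fin n, α j) = k then
        (∫ v : Ev n, f v * (starRingEnd ℂ) (psiXi n α (-ξ) v))
          * (∫ v : Ev n, psiXi n α ξ v * g v)
      else 0) = pairing n (levelProj n ξ k f) g := by
  rw [pairing_levelProj, degreeLevel, Finset.sum_filter]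
  refine Finset.sum_congr rfl fun α _ => ?_
  split_ifs
  · simp only [conj_psiXi_neg]
    rw [pairing_psiLp, pairing_comm, pairing_psiLp]
    simp only [mul_comm]
  · rfl

lemma pairing_resolventRemainder {c C b : ℝ} {l : ℕ} {z : ℂ} (hz : z.re < b)
    (hC : ∀ t : ℝ, 0 < t → ‖truncSemigroup n ξ c l t‖ ≤ C * Real.exp (-(b * t)))
    (f g : HV n) :
    pairing n (resolventRemainder n ξ c l z f) g
      = ∫ t in Set.Ioi (0 : ℝ), Complex.exp (t * z) * pairing n (truncSemigroup n ξ c l t f) g := by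
  have h := ContinuousLinearMap.integral_comp_comm
    (((pairing n).flip g).comp (ContinuousLinearMap.apply ℂ (HV n) f))
    (integrableOn_cexp_smul (aestronglyMeasurable_truncSemigroup ξ c l) hC hz)
  refine h.symm.trans ?_
  simp only [ContinuousLinearMap.comp_apply, ContinuousLinearMap.apply_apply,
    ContinuousLinearMap.flip_apply, map_smul, smul_eq_mul]

lemma pairing_resolventRemainder_psiLp {c C b : ℝ} {l : ℕ} {z : ℂ} (hz : z.re < b)
    (hC : ∀ t : ℝ, 0 < t → ‖truncSemigroup n ξ c l t‖ ≤ C * Real.exp (-(b * t)))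
    (f : HV n) (β : Fin n → ℕ)
    (hβ : ∑ j, β j ≤ l → z.re < ‖ξ‖ ^ 2 ∨ c = 1) (hb : b ≤ l + 1) :
    (((‖ξ‖ ^ 2 + ((∑ j, β j : ℕ) : ℝ) : ℝ) : ℂ) - z)
        * pairing n (resolventRemainder n ξ c l z f) (psiLp n ξ β)
      = ((1 - if ∑ j, β j ≤ l then c else 0 : ℝ) : ℂ) * pairing n f (psiLp n ξ β) := by
  set m := ∑ j, β j with hm
  set q : ℝ := 1 - if m ≤ l then c else 0 with hq
  rw [pairing_resolventRemainder ξ hz hC]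
  have h1 : ∀ t ∈ Set.Ioi (0 : ℝ), Complex.exp (t * z)
      * pairing n (truncSemigroup n ξ c l t f) (psiLp n ξ β)
      = (q : ℂ) * pairing n f (psiLp n ξ β)
        * Complex.exp ((z - ((‖ξ‖ ^ 2 + (m : ℝ) : ℝ) : ℂ)) * t) := by
    intro t ht
    have h2 : Complex.exp ((z - ((‖ξ‖ ^ 2 + (m : ℝ) : ℝ) : ℂ)) * t) = Complex.exp (t * z)
        * (Real.exp (-t * (‖ξ‖ ^ 2 + (m : ℝ))) : ℂ) := by
      rw [Complex.ofReal_exp, ← Complex.exp_add]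
      push_cast
      ring_nf
    rw [pairing_truncSemigroup_psiLp ξ c l ht, h2, ← hm, ← hq]
    ring
  rw [setIntegral_congr_fun measurableSet_Ioi h1, integral_const_mul]
  by_cases hre : z.re < ‖ξ‖ ^ 2 + (m : ℝ)
  · have h3 : (z - ((‖ξ‖ ^ 2 + (m : ℝ) : ℝ) : ℂ)).re < 0 := by
      rw [Complex.sub_re, Complex.ofReal_re]
      linarith
    rw [integral_exp_mul_complex_Ioi h3]
    have h4 : z - ((‖ξ‖ ^ 2 + (m : ℝ) : ℝ) : ℂ) ≠ 0 := fun h => by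
      rw [h] at h3
      exact lt_irrefl _ h3
    rw [← neg_sub z]
    simp only [Complex.ofReal_zero, mul_zero, Complex.exp_zero]
    field_simp
  · have hml : m ≤ l := by
      by_contra hml
      have : ((l : ℝ) + 1) ≤ m := by exact_mod_cast not_le.1 hml
      nlinarith [sq_nonneg ‖ξ‖]
    have hc : c = 1 := (hβ hml).resolve_left fun h => hre (by
      have := Nat.cast_nonneg (α := ℝ) m
      linarith)
    have hq0 : q = 0 := by simp [hq, hml, hc]
    simp [hq0]

lemma IsResV.pairing_eq {c C b : ℝ} {l : ℕ} {z : ℂ} (hz : z.re < b)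
    (hC : ∀ t : ℝ, 0 < t → ‖truncSemigroup n ξ c l t‖ ≤ C * Real.exp (-(b * t)))
    (hz0 : z.im ≠ 0) (hc : z.re < ‖ξ‖ ^ 2 ∨ c = 1) (hb : b ≤ l + 1)
    {R : HV n →L[ℂ] HV n} (hR : IsResV n ξ z R) (f g : HV n) :
    pairing n (R f) g = (∑ k ∈ Finset.range (l + 1),
        (c : ℂ) / (((‖ξ‖ ^ 2 + k : ℝ) : ℂ) - z) * pairing n (levelProj n ξ k f) g)
      + pairing n (resolventRemainder n ξ c l z f) g := by
  have h : pairing n (R f) = (∑ k ∈ Finset.range (l + 1),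
        ((c : ℂ) / (((‖ξ‖ ^ 2 + k : ℝ) : ℂ) - z)) • pairing n (levelProj n ξ k f))
      + pairing n (resolventRemainder n ξ c l z f) := by
    refine ext_of_psiLp ξ fun β => ?_
    have hne : ∀ x : ℝ, (x : ℂ) - z ≠ 0 := fun x hx => hz0 (by
      have := congrArg Complex.im hx
      simpa using this)
    have h1 := hR.pairing_psiLp ξ f β
    have h2 := pairing_resolventRemainder_psiLp ξ hz hC f β (fun _ => hc) hb
    have h3 := hne (‖ξ‖ ^ 2 + ((∑ j, β j : ℕ) : ℝ))
    simp only [add_apply, sum_apply, smul_apply, smul_eq_mul, pairing_levelProj_comm,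
      levelProj_psiLp]
    refine mul_left_cancel₀ h3 ?_
    rw [mul_add, h1, h2]
    have h4 : ∀ k : ℕ, ((c : ℂ) / (((‖ξ‖ ^ 2 + (k : ℝ) : ℝ) : ℂ) - z))
        * pairing n f (if ∑ j, β j = k then psiLp n ξ β else 0)
        = if ∑ j, β j = k then (c : ℂ) / (((‖ξ‖ ^ 2 + ((∑ j, β j : ℕ) : ℝ) : ℝ) : ℂ) - z)
          * pairing n f (psiLp n ξ β) else 0 := fun k => by
      split_ifs with hk
      · rw [hk]
      · simp
    simp only [h4, Finset.sum_ite_eq, Finset.mem_range, Nat.lt_succ_iff]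
    split_ifs
    · field_simp
      push_cast
      ring
    · simp
  rw [h]
  simp only [add_apply, sum_apply, smul_apply, smul_eq_mul]

end remainder

/-- **Proposition 2.1**.  Let l ∈ ℕ and l < a < l+1, and let χ ∈ C₀^∞(ℝⁿ) with 0 ≤ χ ≤ 1,
supp χ ⊂ {|ξ| ≤ a+4} and χ = 1 on {|ξ| ≤ a+3}.  Then for every ξ ∈ ℝⁿ and every z ∈ ℂ with
Re z < a and Im z ≠ 0,
  (P̂₀(ξ) − z)^{−1} = Σ_{k=0}^{l} χ(ξ) Π_k^ξ/(ξ²+k−z) + r_l(z,ξ),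
where Π_k^ξ φ = Σ_{|α|=k} ⟨φ, ψ_α^{−ξ}⟩ ψ_α^ξ is the Riesz projection, r_l(·,ξ) is
holomorphic on {Re z < a}, and sup_{Re z < a, ξ} ‖r_l(z,ξ)‖_{ℬ(L²(ℝⁿ_v))} < ∞.
The operator identity is expressed through matrix elements ∫ (Rf)·g, f, g ∈ L². -/
theorem statement2
    (n : ℕ) (hn : 1 ≤ n) (l : ℕ) (a : ℝ) (ha1 : (l : ℝ) < a) (ha2 : a < (l : ℝ) + 1)
    (χ : Ev n → ℝ) (hχs : ContDiff ℝ (⊤ : ℕ∞) χ) (hχc : HasCompactSupport χ)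
    (hχ01 : ∀ ξ : Ev n, 0 ≤ χ ξ ∧ χ ξ ≤ 1)
    (hsupp : ∀ ξ : Ev n, a + 4 < ‖ξ‖ → χ ξ = 0)
    (hone : ∀ ξ : Ev n, ‖ξ‖ ≤ a + 3 → χ ξ = 1) :
    ∃ r : ℂ → Ev n → (HV n →L[ℂ] HV n),
      -- holomorphy of r_l(·,ξ) on {Re z < a} :
      (∀ ξ : Ev n, DifferentiableOn ℂ (fun z => r z ξ) {z : ℂ | z.re < a}) ∧
      -- uniform bound :
      (∃ M : ℝ, ∀ z : ℂ, ∀ ξ : Ev n, z.re < a → ‖r z ξ‖ ≤ M) ∧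
      -- the resolvent identity :
      (∀ ξ : Ev n, ∀ z : ℂ, z.re < a → z.im ≠ 0 →
        ∀ R : HV n →L[ℂ] HV n, IsResV n ξ z R →
          ∀ f g : HV n,
            ∫ v : Ev n, (R f) v * g v
              = (∑ k ∈ Finset.range (l + 1), ((χ ξ : ℝ) : ℂ) / (((‖ξ‖ ^ 2 + k : ℝ) : ℂ) - z)
                  * ∑ α ∈ Fintype.piFinset (fun _ : Fin n => Finset.range (k + 1)),
                      if (∑ j : Fin n, α j) = k then
                        (∫ v : Ev n, f v * (starRingEnd ℂ) (psiXi n α (-ξ) v))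
                          * (∫ v : Ev n, psiXi n α ξ v * g v)
                      else 0)
                + ∫ v : Ev n, (r z ξ f) v * g v) := by
  have hl : (0 : ℝ) ≤ l := Nat.cast_nonneg l
  obtain ⟨C, hC0, hC⟩ := exists_norm_truncSemigroup_le n l ha1.le
  have hF : ∀ (ξ : Ev n) (t : ℝ), 0 < t →
      ‖truncSemigroup n ξ (χ ξ) l t‖ ≤ C * Real.exp (-((l + 1) * t)) := fun ξ t ht =>
    hC ξ (χ ξ) (hχ01 ξ).1 (hχ01 ξ).2 (hone ξ) (hsupp ξ) t ht
  refine ⟨fun z ξ => resolventRemainder n ξ (χ ξ) l z, fun ξ => ?_,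
    ⟨C / (l + 1 - a), fun z ξ hz => ?_⟩, fun ξ z hz hz0 R hR f g => ?_⟩
  · exact (differentiableOn_integral_cexp_smul (aestronglyMeasurable_truncSemigroup ξ _ l) hC0
      (hF ξ)).mono fun z (hz : z.re < a) => hz.trans ha2
  · refine (norm_integral_cexp_smul_le (hF ξ) (hz.trans ha2)).trans ?_
    exact div_le_div_of_nonneg_left hC0 (sub_pos.2 ha2) (sub_le_sub_left hz.le _)
  · have hc : z.re < ‖ξ‖ ^ 2 ∨ χ ξ = 1 := by
      rcases le_total ‖ξ‖ (a + 3) with h | h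
      · exact Or.inr (hone ξ h)
      · exact Or.inl (by nlinarith)
    have h := hR.pairing_eq ξ (hz.trans ha2) (hF ξ) hz0 hc le_rfl f g
    simp only [← sum_integral_psiXi_eq] at h
    simpa only [pairing_apply] using h

end
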